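/- arXiv:2204.01997 — 3 statements merged into one kernel-verified Lean document; each statement's English description precedes it below -/
import Mathlib

section
/- Let F be a dyadic local field, n ≥ 2, and let W₁, W₂ be n-dimensional quadratic spaces over F with det W₁ = det W₂ = D (mod squares) and W₁ ≇ W₂. Let V be a quadratic space over F with either dim V = n+1, or dim V = n+2 and det V = -D. Then V represents exactly one of W₁ and W₂. -/
noncomputable section
open scoped Classical

/-- A normalized discrete valuation on a field, written additively with values in `ℤ ∪ {∞}`. -/
structure NormDiscValuation (F : Type*) [Field F] : Type _ where
  v : F → WithTop ℤ
  v_zero : v 0 = ⊤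
  v_ne_top : ∀ x : F, x ≠ 0 → v x ≠ ⊤
  v_mul : ∀ x y : F, v (x * y) = v x + v y
  v_add : ∀ x y : F, min (v x) (v y) ≤ v (x + y)
  v_surj : ∀ k : ℤ, ∃ x : F, v x = (k : WithTop ℤ)

variable {F : Type*}

/-- The order of the relative quadratic defect: `d(c) = ord (c⁻¹ 𝔡(c))`, where
`𝔡(c) = ⋂_{x ∈ F} (c - x²) 𝒪_F`; the order of this intersection of principal fractional
ideals is the supremum of the orders `ord ((c - x²)/c)`. -/
def relDefect [Field F] (V : NormDiscValuation F) (c : F) : WithTop ℤ :=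
  ⨆ x : F, V.v ((c - x ^ 2) / c)

/-- `(a, b)_𝔭 = 1` for the Hilbert symbol: `z² = a x² + b y²` has a nontrivial solution. -/
def HilbertOne [Field F] (a b : F) : Prop := ∃ x y : F, a * x ^ 2 + b * y ^ 2 = 1

/-- The diagonal quadratic space `[w 0, …, w (n-1)]`. -/
def diagQF [Field F] (n : ℕ) (w : Fin n → F) : QuadraticMap F (Fin n → F) F :=
  QuadraticMap.weightedSumSquares F w

/-- `Q'` is represented by `Q`: there is an injective isometry from `Q'` into `Q`. -/
def QRep [Field F] {n k : ℕ} (Q : QuadraticMap F (Fin n → F) F)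
    (Q' : QuadraticMap F (Fin k → F) F) : Prop :=
  ∃ f : Q' →qᵢ Q, Function.Injective f

/-- Weights of the diagonal space `ℍ^{(n-l)/2} ⊥ [t₁,…,t_l]`, where `l` is the length of
the list `tail` (each hyperbolic plane being `[1,-1]`). -/
def padDiag [Field F] (n : ℕ) (tail : List F) : Fin n → F := fun i =>
  if (i : ℕ) < n - tail.length then (if (i : ℕ) % 2 = 0 then 1 else -1)
  else tail.getD ((i : ℕ) - (n - tail.length)) 0

section LocalSquares

variable {K : Type*} [NormedField K] [NormedAlgebra ℚ_[2] K]

theorem norm_two_of_normedAlgebra : ‖(2 : K)‖ = 1 / 2 := by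
  have h : ‖algebraMap ℚ_[2] K 2‖ = ‖(2 : ℚ_[2])‖ := norm_algebraMap' K 2
  rw [map_ofNat] at h
  rw [h]
  have := Padic.norm_p (p := 2)
  norm_num at this ⊢
  exact this

theorem norm_add_le_max_of_normedAlgebra (x y : K) : ‖x + y‖ ≤ max ‖x‖ ‖y‖ := by
  have := IsUltrametricDist.of_normedAlgebra (L := K) ℚ_[2]
  exact IsUltrametricDist.norm_add_le_max x y

variable (K) in
/-- The additive group `2ⁿ 𝒪` in a field with a norm extending the `2`-adic one. -/
def twoPowBall (n : ℕ) : AddSubgroup K where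
  carrier := {x | ‖x‖ ≤ (1 / 2) ^ n}
  zero_mem' := by simp
  add_mem' {x y} hx hy := (norm_add_le_max_of_normedAlgebra x y).trans (max_le hx hy)
  neg_mem' {x} hx := by simpa using hx

theorem mem_twoPowBall {n : ℕ} {x : K} : x ∈ twoPowBall K n ↔ ‖x‖ ≤ (1 / 2) ^ n := Iff.rfl

theorem map_two_twoPowBall :
    (twoPowBall K 0).map (AddMonoidHom.mulLeft (2 : K)) = twoPowBall K 1 := by
  have h2 : (2 : K) ≠ 0 := by
    rw [← norm_ne_zero_iff, norm_two_of_normedAlgebra]; norm_num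
  ext x
  simp only [AddSubgroup.mem_map, mem_twoPowBall, AddMonoidHom.coe_mulLeft]
  constructor
  · rintro ⟨y, hy, rfl⟩
    rw [norm_mul, norm_two_of_normedAlgebra]
    simp at hy ⊢
    linarith
  · intro hx
    refine ⟨x / 2, ?_, by field_simp⟩
    rw [norm_div, norm_two_of_normedAlgebra]
    simp at hx ⊢
    linarith

/-- `[ℤ₂ᴺ : 2 ℤ₂ᴺ] = 2ᴺ`. -/
theorem index_two_mul_padicInt_pi (N : ℕ) :
    (AddMonoidHom.mulLeft (2 : Fin N → ℤ_[2])).range.index = 2 ^ N := by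
  let g : (Fin N → ℤ_[2]) →+ (Fin N → ZMod 2) :=
    ((PadicInt.toZMod (p := 2)).compLeft (Fin N)).toAddMonoidHom
  have hg : Function.Surjective g := fun y => by
    choose x hx using fun i => ZMod.ringHom_surjective (PadicInt.toZMod (p := 2)) (y i)
    exact ⟨x, funext hx⟩
  have hker : g.ker = (AddMonoidHom.mulLeft (2 : Fin N → ℤ_[2])).range := by
    ext x
    rw [AddMonoidHom.mem_ker, AddMonoidHom.mem_range]
    have key (a : ℤ_[2]) : PadicInt.toZMod a = 0 ↔ ∃ b, 2 * b = a := by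
      rw [← RingHom.mem_ker, PadicInt.ker_toZMod, PadicInt.maximalIdeal_eq_span_p,
        Ideal.mem_span_singleton]
      exact ⟨fun ⟨b, hb⟩ => ⟨b, hb.symm⟩, fun ⟨b, hb⟩ => ⟨b, hb.symm⟩⟩
    constructor
    · intro h
      choose y hy using fun i => (key (x i)).1 (congrFun h i)
      exact ⟨y, funext hy⟩
    · rintro ⟨y, rfl⟩
      exact funext fun i => (key _).2 ⟨y i, rfl⟩
  rw [← hker, AddSubgroup.index_ker, AddMonoidHom.range_eq_top.2 hg]
  simp [Nat.card_eq_fintype_card]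

variable (K) in
/-- The group of units of norm one that are congruent to `1` modulo `2ⁿ 𝒪`. -/
def twoPowUnits (n : ℕ) : Subgroup Kˣ where
  carrier := {u | ‖(u : K)‖ = 1 ∧ ‖(u : K) - 1‖ ≤ (1 / 2) ^ n}
  one_mem' := by simp
  mul_mem' {u v} hu hv := by
    refine ⟨by simp [hu.1, hv.1], ?_⟩
    have : ((u * v : Kˣ) : K) - 1 = u * (v - 1) + (u - 1) := by push_cast; ring
    rw [this]
    refine (norm_add_le_max_of_normedAlgebra _ _).trans (max_le ?_ hu.2)
    rw [norm_mul, hu.1, one_mul]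
    exact hv.2
  inv_mem' {u} hu := by
    refine ⟨by simp [hu.1], ?_⟩
    have : ((u⁻¹ : Kˣ) : K) - 1 = - ((u⁻¹ : Kˣ) * (u - 1)) := by
      rw [mul_sub, Units.inv_mul]; ring
    rw [this, norm_neg, norm_mul, Units.val_inv_eq_inv_val, norm_inv, hu.1, inv_one, one_mul]
    exact hu.2

theorem mem_twoPowUnits_succ {n : ℕ} {u : Kˣ} :
    u ∈ twoPowUnits K (n + 1) ↔ ‖(u : K) - 1‖ ≤ (1 / 2) ^ (n + 1) := by
  refine ⟨fun h => h.2, fun h => ⟨?_, h⟩⟩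
  have := IsUltrametricDist.of_normedAlgebra (L := K) ℚ_[2]
  have h1 : ‖(u : K) - 1‖ < ‖(1 : K)‖ := by
    rw [norm_one]
    exact h.trans_lt (pow_lt_one₀ (by norm_num) (by norm_num) (by simp))
  have h2 := IsUltrametricDist.norm_add_eq_max_of_norm_ne_norm h1.ne
  rw [sub_add_cancel, max_eq_right h1.le, norm_one] at h2
  exact h2

theorem norm_zpow_two_mul {k : ℤ} {u : K} (hu : ‖u‖ = 1) : ‖(2 : K) ^ k * u‖ = (1 / 2) ^ k := by
  rw [norm_mul, hu, mul_one, norm_zpow, norm_two_of_normedAlgebra]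

variable [FiniteDimensional ℚ_[2] K]

theorem properSpace_of_finiteDimensional_padic : ProperSpace K :=
  FiniteDimensional.proper ℚ_[2] K

theorem relIndex_twoPowBall :
    (twoPowBall K 1).relIndex (twoPowBall K 0) = 2 ^ Module.finrank ℚ_[2] K := by
  have := properSpace_of_finiteDimensional_padic (K := K)
  set N := Module.finrank ℚ_[2] K with hN
  let e : K ≃L[ℚ_[2]] (Fin N → ℚ_[2]) := ContinuousLinearEquiv.ofFinrankEq (by simp [hN])
  obtain ⟨c, hc0, hc⟩ := NormedField.exists_norm_lt ℚ_[2]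
    (show (0 : ℝ) < 1 / (‖(e.symm : (Fin N → ℚ_[2]) →L[ℚ_[2]] K)‖ + 1) by positivity)
  have hc0 : c ≠ 0 := norm_pos_iff.1 hc0
  let f : (Fin N → ℤ_[2]) →+ K :=
    { toFun := fun y => e.symm (c • fun i => (y i : ℚ_[2]))
      map_zero' := by
        have : (c • fun i : Fin N => (((0 : Fin N → ℤ_[2]) i : ℤ_[2]) : ℚ_[2])) = 0 := by
          ext i; simp
        rw [this, map_zero]
      map_add' := fun x y => by
        rw [← map_add, ← smul_add]
        congr 2 }
  have hf (y) : f y = e.symm (c • fun i => (y i : ℚ_[2])) := rfl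
  have hinj : Function.Injective f := fun x y h => by
    rw [hf, hf] at h
    have := smul_right_injective _ hc0 (e.symm.injective h)
    exact funext fun i => Subtype.ext (congrFun this i)
  set M := f.range with hM
  have hMO : M ≤ twoPowBall K 0 := by
    rintro _ ⟨y, rfl⟩
    rw [mem_twoPowBall, pow_zero, hf]
    have h1 := (e.symm : (Fin N → ℚ_[2]) →L[ℚ_[2]] K).le_opNorm (c • fun i => (y i : ℚ_[2]))
    have h2 : ‖c • fun i => (y i : ℚ_[2])‖ ≤ ‖c‖ := by
      rw [norm_smul]
      refine mul_le_of_le_one_right (norm_nonneg _) ?_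
      exact (pi_norm_le_iff_of_nonneg zero_le_one).2 fun i => PadicInt.norm_le_one _
    refine h1.trans ?_
    set C := ‖(e.symm : (Fin N → ℚ_[2]) →L[ℚ_[2]] K)‖
    have hC : 0 ≤ C := norm_nonneg _
    rw [lt_div_iff₀ (by positivity)] at hc
    calc _ ≤ C * ‖c‖ := by gcongr
      _ ≤ 1 := by nlinarith [norm_nonneg c]
  have hMopen : IsOpen (M : Set K) := by
    refine AddSubgroup.isOpen_of_mem_nhds M (g := 0) ?_
    have hcont : Continuous fun x : K => ‖c⁻¹ • e x‖ := by fun_prop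
    have : {x : K | ‖c⁻¹ • e x‖ < 1} ∈ nhds (0 : K) :=
      (isOpen_lt hcont continuous_const).mem_nhds (by simp)
    filter_upwards [this] with x hx
    have hx' : ∀ i, ‖(c⁻¹ • e x) i‖ ≤ 1 := fun i => (norm_le_pi_norm _ i).trans hx.le
    refine ⟨fun i => ⟨(c⁻¹ • e x) i, hx' i⟩, ?_⟩
    refine (hf _).trans ((ContinuousLinearEquiv.symm_apply_eq _).2 ?_)
    exact smul_inv_smul₀ hc0 _
  have hfin : M.relIndex (twoPowBall K 0) ≠ 0 := by
    have hcomp : IsCompact (twoPowBall K 0 : Set K) := by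
      convert! isCompact_closedBall (0 : K) 1
      ext x; simp [mem_twoPowBall]
    have := isCompact_iff_compactSpace.1 hcomp
    have ho : IsOpen ((M.addSubgroupOf (twoPowBall K 0) : AddSubgroup _) : Set (twoPowBall K 0)) :=
      hMopen.preimage continuous_subtype_val
    have : Finite (twoPowBall K 0 ⧸ M.addSubgroupOf (twoPowBall K 0)) :=
      AddSubgroup.quotient_finite_of_isOpen _ ho
    exact AddSubgroup.index_ne_zero_of_finite
  have h2 : (2 : K) ≠ 0 := by
    rw [← norm_ne_zero_iff, norm_two_of_normedAlgebra]; norm_num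
  have h2inj : Function.Injective (AddMonoidHom.mulLeft (2 : K)) := mul_right_injective₀ h2
  have h2M : M.map (AddMonoidHom.mulLeft (2 : K)) =
      (AddMonoidHom.mulLeft (2 : Fin N → ℤ_[2])).range.map f := by
    rw [hM, AddMonoidHom.map_range, AddMonoidHom.map_range]
    congr 1
    ext y
    simp [two_mul]
  have hMM : (M.map (AddMonoidHom.mulLeft (2 : K))).relIndex M = 2 ^ N := by
    rw [h2M, hM, AddMonoidHom.range_eq_map f, AddSubgroup.relIndex_map_map_of_injective _ _ hinj,
      AddSubgroup.relIndex_top_right, index_two_mul_padicInt_pi]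
  have hle : M.map (AddMonoidHom.mulLeft (2 : K)) ≤ M := by
    rw [h2M]; rintro _ ⟨y, -, rfl⟩; exact ⟨y, rfl⟩
  have e1 := AddSubgroup.relIndex_mul_relIndex _ _ _ hle hMO
  have hle2 : M.map (AddMonoidHom.mulLeft (2 : K)) ≤ twoPowBall K 1 := by
    rw [← map_two_twoPowBall]; exact AddSubgroup.map_mono hMO
  have e2 := AddSubgroup.relIndex_mul_relIndex _ _ (twoPowBall K 0) hle2 (fun x hx => by
    rw [mem_twoPowBall] at hx ⊢; exact hx.trans (by norm_num))
  nth_rewrite 1 [← map_two_twoPowBall] at e2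
  rw [AddSubgroup.relIndex_map_map_of_injective _ _ h2inj, ← e1, hMM, mul_comm (2 ^ N)] at e2
  exact Nat.eq_of_mul_eq_mul_left (Nat.pos_of_ne_zero hfin) e2

theorem exists_add_two_mul_sq_eq {y : K} (hy : ‖y‖ ≤ 1) : ∃ x : K, ‖x‖ ≤ 1 ∧ x + 2 * x ^ 2 = y := by
  have := properSpace_of_finiteDimensional_padic (K := K)
  let s : Set K := {x | ‖x‖ ≤ 1}
  have hsc : IsComplete s := (isClosed_le continuous_norm continuous_const).isComplete
  let g : K → K := fun x => y + -(2 * x ^ 2)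
  have hg : Set.MapsTo g s s := fun x hx => by
    refine (norm_add_le_max_of_normedAlgebra _ _).trans (max_le hy ?_)
    rw [norm_neg, norm_mul, norm_pow, norm_two_of_normedAlgebra]
    have : ‖x‖ ^ 2 ≤ 1 := pow_le_one₀ (norm_nonneg _) hx
    linarith
  have hc : ContractingWith (1 / 2) (hg.restrict g s s) := by
    refine ⟨by rw [← NNReal.coe_lt_coe]; norm_num, LipschitzWith.of_dist_le_mul ?_⟩
    rintro ⟨a, ha⟩ ⟨b, hb⟩
    change dist (g a) (g b) ≤ _ * dist a b
    rw [dist_eq_norm, dist_eq_norm]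
    have : g a - g b = -(2 * ((a + b) * (a - b))) := by simp only [g]; ring
    rw [this, norm_neg, norm_mul, norm_mul, norm_two_of_normedAlgebra]
    have h1 : ‖a + b‖ ≤ 1 := (norm_add_le_max_of_normedAlgebra _ _).trans (max_le ha hb)
    have := mul_le_of_le_one_left (norm_nonneg (a - b)) h1
    push_cast
    linarith
  obtain ⟨x, hx, hfix, -⟩ := hc.exists_fixedPoint' hsc hg (x := 0) (by simp [s]) (edist_ne_top _ _)
  refine ⟨x, hx, ?_⟩
  have : y + -(2 * x ^ 2) = x := hfix
  nth_rewrite 1 [← this]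
  ring

theorem map_sq_twoPowUnits :
    (twoPowUnits K 2).map (powMonoidHom 2) = twoPowUnits K 3 := by
  have h2 : ‖(2 : K)‖ = 1 / 2 := norm_two_of_normedAlgebra
  have h20 : (2 : K) ≠ 0 := by rw [← norm_ne_zero_iff, h2]; norm_num
  ext u
  rw [Subgroup.mem_map, mem_twoPowUnits_succ]
  constructor
  · rintro ⟨v, hv, rfl⟩
    rw [mem_twoPowUnits_succ] at hv
    have : (((powMonoidHom 2 v : Kˣ)) : K) - 1 = (v - 1) * (2 + (v - 1)) := by
      simp; ring
    rw [this, norm_mul]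
    have h4 : ‖(2 : K) + (v - 1)‖ ≤ 1 / 2 := (norm_add_le_max_of_normedAlgebra _ _).trans
      (max_le h2.le (hv.trans (by norm_num)))
    calc _ ≤ (1 / 2 : ℝ) ^ (1 + 1) * (1 / 2) := by gcongr
      _ = _ := by norm_num
  · intro hu
    obtain ⟨x, hx, hxy⟩ := exists_add_two_mul_sq_eq (y := ((u : K) - 1) / 2 ^ 3) (by
      rw [norm_div, norm_pow, h2, div_le_one (by positivity)]; exact hu)
    have h4x : ‖1 + 4 * x - 1‖ ≤ (1 / 2) ^ (1 + 1) := by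
      have : 1 + 4 * x - 1 = 2 ^ 2 * x := by ring
      rw [this, norm_mul, norm_pow, h2]
      exact mul_le_of_le_one_right (by norm_num) hx
    have hsq : (1 + 4 * x) ^ 2 = u := by
      rw [eq_div_iff (by positivity)] at hxy
      linear_combination hxy
    have hne : 1 + 4 * x ≠ 0 := fun h => u.ne_zero (by rw [← hsq, h]; simp)
    exact ⟨Units.mk0 _ hne, mem_twoPowUnits_succ.2 h4x, Units.ext hsq⟩

theorem relIndex_twoPowUnits :
    (twoPowUnits K 3).relIndex (twoPowUnits K 2) = 2 ^ Module.finrank ℚ_[2] K := by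
  have h2 : ‖(2 : K)‖ = 1 / 2 := norm_two_of_normedAlgebra
  have h20 : (2 : K) ≠ 0 := by rw [← norm_ne_zero_iff, h2]; norm_num
  have h40 : (4 : K) ≠ 0 := by
    have : (4 : K) = 2 ^ 2 := by norm_num
    rw [this]; positivity
  have h4 : ‖(4 : K)‖ = 1 / 4 := by
    have : (4 : K) = 2 ^ 2 := by norm_num
    rw [this, norm_pow, h2]; norm_num
  let O := twoPowBall K 0
  let B : AddSubgroup O := (twoPowBall K 1).addSubgroupOf O
  have hmem (u : twoPowUnits K 2) : ((u : Kˣ) - 1 : K) / 4 ∈ O := by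
    rw [mem_twoPowBall, norm_div, h4, pow_zero, div_le_one (by norm_num)]
    exact u.2.2.trans (by norm_num)
  let f : twoPowUnits K 2 →* Multiplicative (O ⧸ B) :=
    MonoidHom.mk' (fun u => Multiplicative.ofAdd (QuotientAddGroup.mk ⟨_, hmem u⟩)) <| by
      intro u v
      rw [← ofAdd_add, ← QuotientAddGroup.mk_add]
      congr 1
      refine (QuotientAddGroup.eq).2 ?_
      rw [AddSubgroup.mem_addSubgroupOf, mem_twoPowBall]
      have : ((-(⟨_, hmem (u * v)⟩ : O) + (⟨_, hmem u⟩ + ⟨_, hmem v⟩) : O) : K) =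
          -(4 * (((u : Kˣ) - 1 : K) / 4 * (((v : Kˣ) - 1 : K) / 4))) := by
        push_cast
        field_simp
        ring
      rw [this, norm_neg, norm_mul, h4, norm_mul]
      have hu := hmem u
      have hv := hmem v
      rw [mem_twoPowBall, pow_zero] at hu hv
      nlinarith [norm_nonneg (((u : Kˣ) - 1 : K) / 4), norm_nonneg (((v : Kˣ) - 1 : K) / 4),
        mul_le_one₀ hu (norm_nonneg _) hv]
  have hker : f.ker = (twoPowUnits K 3).subgroupOf (twoPowUnits K 2) := by
    ext u
    rw [MonoidHom.mem_ker, Subgroup.mem_subgroupOf, mem_twoPowUnits_succ]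
    change Multiplicative.ofAdd (QuotientAddGroup.mk (⟨_, hmem u⟩ : O) : O ⧸ B) = 1 ↔ _
    rw [ofAdd_eq_one, QuotientAddGroup.eq_zero_iff, AddSubgroup.mem_addSubgroupOf,
      mem_twoPowBall, norm_div, h4, div_le_iff₀ (by norm_num)]
    norm_num
  have hsurj : Function.Surjective f := by
    intro q
    obtain ⟨⟨x, hx⟩, hq⟩ := QuotientAddGroup.mk_surjective q.toAdd
    have hx' : ‖1 + 4 * x - 1‖ ≤ (1 / 2) ^ (1 + 1) := by
      have : 1 + 4 * x - 1 = 4 * x := by ring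
      rw [this, norm_mul, h4]
      rw [mem_twoPowBall, pow_zero] at hx
      norm_num
      linarith
    have hne : 1 + 4 * x ≠ 0 := fun h => by
      rw [h] at hx'
      norm_num at hx'
    refine ⟨⟨Units.mk0 _ hne, mem_twoPowUnits_succ.2 hx'⟩, ?_⟩
    change Multiplicative.ofAdd (QuotientAddGroup.mk (⟨_, hmem _⟩ : O) : O ⧸ B) = _
    rw [← ofAdd_toAdd q, ← hq]
    congr 3
    simp only [Units.val_mk0]
    field_simp
    ring
  rw [Subgroup.relIndex, ← hker, Subgroup.index_ker, MonoidHom.range_eq_top.2 hsurj,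
    Subgroup.card_top, ← relIndex_twoPowBall]
  rfl

theorem index_squares_of_normedField :
    (powMonoidHom 2 : Kˣ →* Kˣ).range.index = 4 * 2 ^ Module.finrank ℚ_[2] K := by
  have := properSpace_of_finiteDimensional_padic (K := K)
  have h2 : ‖(2 : K)‖ = 1 / 2 := norm_two_of_normedAlgebra
  have h20 : (2 : K) ≠ 0 := by rw [← norm_ne_zero_iff, h2]; norm_num
  let t : Kˣ := Units.mk0 2 h20
  let φ : Kˣ →* Kˣ := powMonoidHom 2
  let U := twoPowUnits K 2
  let A := Subgroup.zpowers t ⊔ U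
  let B := Subgroup.zpowers (t ^ 2) ⊔ U
  have norm_of_mem {k : ℤ} {u : Kˣ} (hu : u ∈ U) : ‖((t ^ k * u : Kˣ) : K)‖ = (1 / 2) ^ k := by
    push_cast
    exact norm_zpow_two_mul hu.1
  have hhalf : Function.Injective fun k : ℤ => (1 / 2 : ℝ) ^ k :=
    zpow_right_injective₀ (by norm_num) (by norm_num)
  have memA {x : Kˣ} : x ∈ A ↔ ∃ k : ℤ, ∃ u ∈ U, t ^ k * u = x := by
    simp [A, Subgroup.mem_sup, Subgroup.mem_zpowers_iff]
  have memB {x : Kˣ} : x ∈ B ↔ ∃ k : ℤ, ∃ u ∈ U, t ^ (2 * k) * u = x := by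
    simp [B, Subgroup.mem_sup, Subgroup.mem_zpowers_iff, zpow_mul]
  have hφA : A.map φ = Subgroup.zpowers (t ^ 2) ⊔ twoPowUnits K 3 := by
    rw [Subgroup.map_sup, map_sq_twoPowUnits, MonoidHom.map_zpowers]
    rfl
  have hφU : A.map φ ⊓ U = twoPowUnits K 3 := by
    have h32 : twoPowUnits K 3 ≤ U := fun u hu => ⟨hu.1, hu.2.trans (by norm_num)⟩
    rw [hφA]
    refine le_antisymm ?_ (le_inf le_sup_right h32)
    rintro x ⟨hx, hxU⟩
    obtain ⟨y, hy, v, hv, rfl⟩ := Subgroup.mem_sup.1 hx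
    obtain ⟨k, rfl⟩ := Subgroup.mem_zpowers_iff.1 hy
    have h1 := norm_of_mem (k := 2 * k) (h32 hv)
    have h3 : (t ^ 2) ^ k = t ^ (2 * k) := by rw [zpow_mul]; rfl
    rw [h3] at hxU ⊢
    have h0 := h1.symm.trans hxU.1
    have : 2 * k = 0 := hhalf (h0.trans (zpow_zero _).symm)
    rw [this, zpow_zero, one_mul]
    exact hv
  have hBA : B ≤ A := fun x hx => by
    obtain ⟨k, u, hu, rfl⟩ := memB.1 hx
    exact memA.2 ⟨_, u, hu, rfl⟩
  have hB : B = U ⊔ A.map φ := by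
    rw [hφA]
    have h32 : twoPowUnits K 3 ≤ U := fun u hu => ⟨hu.1, hu.2.trans (by norm_num)⟩
    refine le_antisymm (sup_le (le_sup_left.trans le_sup_right) le_sup_left) ?_
    exact sup_le le_sup_right (sup_le le_sup_left (h32.trans le_sup_right))
  have e1 : (A.map φ).relIndex B = 2 ^ Module.finrank ℚ_[2] K := by
    rw [hB, Subgroup.relIndex_sup_right, ← Subgroup.inf_relIndex_right, hφU, relIndex_twoPowUnits]
  have e2 : B.relIndex A = 2 := by
    refine Subgroup.relIndex_eq_two_iff.2 ⟨t, memA.2 ⟨1, 1, U.one_mem, by simp⟩, fun x hx => ?_⟩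
    obtain ⟨k, u, hu, rfl⟩ := memA.1 hx
    have key (k : ℤ) : t ^ k * u ∈ B ↔ Even k := by
      rw [memB]
      constructor
      · rintro ⟨l, v, hv, h⟩
        have h1 := norm_of_mem (k := k) hu
        rw [← h, norm_of_mem hv] at h1
        exact ⟨l, by rw [← hhalf h1]; ring⟩
      · rintro ⟨l, rfl⟩
        exact ⟨l, u, hu, by rw [two_mul]⟩
    have : t ^ k * u * t = t ^ (k + 1) * u := by rw [zpow_add_one]; exact mul_right_comm _ _ _
    rw [this, key, key, Int.even_add_one]
    by_cases h : Even k <;> simp [h, Xor]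
  have hAfin : A.index ≠ 0 := by
    have hS : IsCompact {x : K | 1 / 2 ≤ ‖x‖ ∧ ‖x‖ ≤ 1} := by
      refine (isCompact_closedBall (0 : K) 1).of_isClosed_subset ?_ fun x hx => by simpa using hx.2
      exact (isClosed_le continuous_const continuous_norm).inter
        (isClosed_le continuous_norm continuous_const)
    obtain ⟨T, hTS, hTfin, hT⟩ := hS.finite_cover_balls (e := 1 / 8) (by norm_num)
    let q : T → Kˣ ⧸ A := fun s => QuotientGroup.mk (Units.mk0 (s : K) (by
      have := (hTS s.2).1
      rw [← norm_pos_iff]; linarith))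
    have hq : Function.Surjective q := by
      intro y
      obtain ⟨x, rfl⟩ := QuotientGroup.mk_surjective y
      obtain ⟨k, hk1, hk2⟩ := exists_mem_Ioc_zpow (y := (2 : ℝ)) (norm_pos_iff.2 x.ne_zero)
        (by norm_num)
      have hn : ‖((t ^ (k + 1) * x : Kˣ) : K)‖ = ‖(x : K)‖ / 2 ^ (k + 1) := by
        push_cast
        rw [norm_mul, norm_zpow]
        change ‖(2 : K)‖ ^ _ * _ = _
        rw [h2, one_div, inv_zpow, div_eq_inv_mul]
      have hmem : ((t ^ (k + 1) * x : Kˣ) : K) ∈ {x : K | 1 / 2 ≤ ‖x‖ ∧ ‖x‖ ≤ 1} := by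
        rw [Set.mem_ofPred_eq, hn]
        rw [zpow_add_one₀ (by norm_num)] at *
        constructor
        · rw [le_div_iff₀ (by positivity)]; linarith
        · rw [div_le_one (by positivity)]; exact hk2
      obtain ⟨s, hs, hxs⟩ := Set.mem_iUnion₂.1 (hT hmem)
      refine ⟨⟨s, hs⟩, ?_⟩
      refine QuotientGroup.eq.2 ?_
      have hs1 := (hTS hs).1
      have hs0 : s ≠ 0 := by rw [← norm_pos_iff]; linarith
      refine memA.2 ⟨-(k + 1), (Units.mk0 s hs0)⁻¹ * (t ^ (k + 1) * x), ?_, ?_⟩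
      · refine mem_twoPowUnits_succ.2 ?_
        rw [Metric.mem_ball, dist_eq_norm] at hxs
        have : (((Units.mk0 s hs0)⁻¹ * (t ^ (k + 1) * x) : Kˣ) : K) - 1 =
            (((t ^ (k + 1) * x : Kˣ) : K) - s) / s := by
          rw [Units.val_mul, Units.val_inv_eq_inv_val, Units.val_mk0]
          field_simp
        rw [this, norm_div, div_le_iff₀ (by linarith)]
        norm_num at hxs ⊢
        linarith
      · rw [mul_left_comm, ← mul_assoc (t ^ _), ← zpow_add, neg_add_cancel, zpow_zero, one_mul]
    have := hTfin.to_subtype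
    have : Finite (Kˣ ⧸ A) := Finite.of_surjective q hq
    exact Subgroup.index_ne_zero_of_finite
  have hne : (-1 : Kˣ) ≠ 1 := by
    intro h
    have : (-1 : K) = 1 := congrArg Units.val h
    apply h20
    linear_combination -this
  have mem_ker (x : Kˣ) : x ∈ φ.ker ↔ x = 1 ∨ x = -1 := by
    rw [MonoidHom.mem_ker]
    constructor
    · intro h
      have h1 : (x : K) * x = 1 := by
        rw [← sq]; exact congrArg Units.val h
      exact (mul_self_eq_one_iff.1 h1).imp (fun h => Units.ext h) (fun h => Units.ext h)
    · rintro (rfl | rfl) <;> simp [φ]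
  have hnegA : (-1 : Kˣ) ∉ A := fun h => by
    obtain ⟨k, u, hu, hk⟩ := memA.1 h
    have h1 := norm_of_mem (k := k) hu
    have h0 : k = 0 := hhalf (h1.symm.trans (by rw [hk]; simp))
    rw [h0, zpow_zero, one_mul] at hk
    have h3 := (mem_twoPowUnits_succ.1 hu)
    have h4 : ((-1 : Kˣ) : K) - 1 = -2 := by push_cast; ring
    rw [hk, h4, norm_neg, h2] at h3
    norm_num at h3
  have e3 : A.relIndex φ.ker = 2 := by
    refine Subgroup.relIndex_eq_two_iff.2 ⟨-1, (mem_ker _).2 (Or.inr rfl), fun b hb => ?_⟩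
    rcases (mem_ker b).1 hb with rfl | rfl <;> simp [Xor, hnegA, A.one_mem]
  have e4 : 2 * (A ⊔ φ.ker).index = A.index := by
    rw [← Subgroup.relIndex_mul_index (le_sup_left : A ≤ A ⊔ φ.ker), sup_comm,
      Subgroup.relIndex_sup_right, e3]
  have hle : A.map φ ≤ B := by rw [hB]; exact le_sup_right
  have e5 := Subgroup.relIndex_mul_relIndex _ _ _ hle hBA
  have e6 := Subgroup.relIndex_mul_index (hle.trans hBA)
  rw [← e5, e1, e2, Subgroup.index_map, ← e4] at e6
  have hpos : 0 < (A ⊔ φ.ker).index := by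
    have : (A ⊔ φ.ker).index ≠ 0 := fun h => hAfin (by rw [← e4, h])
    exact Nat.pos_of_ne_zero this
  refine Nat.eq_of_mul_eq_mul_left hpos ?_
  change _ * φ.range.index = _
  rw [← e6]
  ring

end LocalSquares

/-- The local square theorem: a finite extension `K` of `ℚ₂` of degree `N` has `4 · 2ᴺ` square
classes. -/
theorem index_squares_of_finiteDimensional_padic (K : Type*) [Field K] [Algebra ℚ_[2] K]
    [FiniteDimensional ℚ_[2] K] :
    (powMonoidHom 2 : Kˣ →* Kˣ).range.index = 4 * 2 ^ Module.finrank ℚ_[2] K := by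
  let := spectralNorm.normedField ℚ_[2] K
  let : NormedAlgebra ℚ_[2] K := spectralNorm.normedAlgebra ℚ_[2] K
  exact index_squares_of_normedField

section NormGroup

variable {F : Type*} [Field F]

/-- The group of nonzero values of the binary form `[1, -a]`. -/
def normGroup (a : Fˣ) : Subgroup Fˣ where
  carrier := {c | ∃ x y : F, (c : F) = x ^ 2 - a * y ^ 2}
  one_mem' := ⟨1, 0, by simp⟩
  mul_mem' := by
    rintro c d ⟨x, y, hc⟩ ⟨z, w, hd⟩
    exact ⟨x * z + a * y * w, x * w + y * z, by rw [Units.val_mul, hc, hd]; ring⟩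
  inv_mem' := by
    rintro c ⟨x, y, hc⟩
    refine ⟨x / c, y / c, ?_⟩
    have := c.ne_zero
    rw [Units.val_inv_eq_inv_val]
    field_simp
    exact hc

theorem mem_normGroup {a c : Fˣ} : c ∈ normGroup a ↔ ∃ x y : F, (c : F) = x ^ 2 - a * y ^ 2 :=
  Iff.rfl

theorem sq_mem_normGroup (a c : Fˣ) : c ^ 2 ∈ normGroup a := ⟨c, 0, by simp⟩

variable [Algebra ℚ_[2] F] [FiniteDimensional ℚ_[2] F]

theorem index_normGroup {a : Fˣ} (ha : ¬ IsSquare a) : (normGroup a).index = 2 := by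
  have : CharZero F := charZero_of_injective_algebraMap (algebraMap ℚ_[2] F).injective
  have : Fact (∀ r : F, r ^ 2 ≠ (a : F) + 0 * r) := ⟨fun r hr => by
    rw [zero_mul, add_zero] at hr
    have hr0 : r ≠ 0 := fun h => a.ne_zero (by rw [← hr, h]; simp)
    exact ha ⟨Units.mk0 r hr0, Units.ext (by rw [← hr, sq]; rfl)⟩⟩
  let E := QuadraticAlgebra F (a : F) 0
  have : FiniteDimensional ℚ_[2] E := FiniteDimensional.trans ℚ_[2] F E
  have hfin : Module.finrank ℚ_[2] E = Module.finrank ℚ_[2] F * 2 := by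
    rw [← Module.finrank_mul_finrank ℚ_[2] F E, QuadraticAlgebra.finrank_eq_two]
  let SF := (powMonoidHom 2 : Fˣ →* Fˣ).range
  let SE := (powMonoidHom 2 : Eˣ →* Eˣ).range
  have hF : SF.index = 4 * 2 ^ Module.finrank ℚ_[2] F := index_squares_of_finiteDimensional_padic F
  have hE : SE.index = 4 * 2 ^ Module.finrank ℚ_[2] E := index_squares_of_finiteDimensional_padic E
  let ψ : Eˣ →* Fˣ := Units.map (QuadraticAlgebra.norm : E →* F)
  let ι : Fˣ →* Eˣ := Units.map (algebraMap F E : F →* E)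
  have hψ (z : Eˣ) : ((ψ z : Fˣ) : F) = (z : E).re ^ 2 - a * (z : E).im ^ 2 := by
    change QuadraticAlgebra.norm (z : E) = _
    rw [QuadraticAlgebra.norm_def]; ring
  have hrange : ψ.range = normGroup a := by
    ext c
    rw [MonoidHom.mem_range, mem_normGroup]
    constructor
    · rintro ⟨z, rfl⟩
      exact ⟨_, _, hψ z⟩
    · rintro ⟨x, y, hc⟩
      have hne : (⟨x, y⟩ : E) ≠ 0 := fun h => by
        have hx : x = 0 := congrArg QuadraticAlgebra.re h
        have hy : y = 0 := congrArg QuadraticAlgebra.im h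
        exact c.ne_zero (by rw [hc, hx, hy]; ring)
      exact ⟨Units.mk0 _ hne, Units.ext (by rw [hψ, hc]; rfl)⟩
  have hψι (c : Fˣ) : ψ (ι c) = c ^ 2 := Units.ext (by
    rw [hψ]
    change c.1 ^ 2 - a * 0 ^ 2 = _
    push_cast; ring)
  have hστ (z : Eˣ) : ((ι (ψ z) : Eˣ) : E) = z * star (z : E) :=
    QuadraticAlgebra.algebraMap_norm_eq_mul_star _
  have hcomap : SF.comap ψ = SE ⊔ ι.range := by
    apply le_antisymm
    · intro z hz
      obtain ⟨c, hc⟩ := Subgroup.mem_comap.1 hz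
      replace hc : c ^ 2 = ψ z := hc
      obtain ⟨w, rfl⟩ : ∃ w, w * ι c = z := ⟨z * (ι c)⁻¹, by simp⟩
      refine mul_mem ?_ (le_sup_right (a := SE) ⟨c, rfl⟩)
      have hw : ψ w = 1 := by
        rw [map_mul, hψι, right_eq_mul] at hc
        exact hc
      by_cases h : w = -1
      · refine le_sup_right (a := SE) ⟨-1, ?_⟩
        rw [h]
        exact Units.ext (by change algebraMap F E (-1) = _; simp)
      · have hne : (1 : E) + w ≠ 0 := fun h0 => h (Units.ext (by
          rw [Units.val_neg, Units.val_one]; linear_combination h0))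
        let t : Eˣ := Units.mk0 _ hne
        have hws : (w : E) * star (w : E) = 1 := by rw [← hστ, hw, map_one]; rfl
        have htt : w * ι (ψ t) = t ^ 2 := Units.ext (by
          rw [Units.val_mul, hστ]
          change (w : E) * ((1 + w) * star (1 + (w : E))) = ((t ^ 2 : Eˣ) : E)
          rw [star_add, star_one, Units.val_pow_eq_pow_val]
          change _ = (1 + (w : E)) ^ 2
          linear_combination (1 + (w : E)) * hws)
        rw [← eq_mul_inv_iff_mul_eq] at htt
        rw [htt]
        exact mul_mem (le_sup_left (a := SE) ⟨t, rfl⟩)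
          (inv_mem (le_sup_right (a := SE) ⟨_, rfl⟩))
    · refine sup_le ?_ ?_
      · rintro _ ⟨z, rfl⟩
        exact ⟨ψ z, (map_pow ψ z 2).symm⟩
      · rintro _ ⟨c, rfl⟩
        exact ⟨c, (hψι c).symm⟩
  have hT : SF.relIndex (SE.comap ι) = 2 := by
    have haT : a ∈ SE.comap ι := by
      have hne : (⟨0, 1⟩ : E) ≠ 0 := fun h => one_ne_zero (congrArg QuadraticAlgebra.im h)
      refine ⟨Units.mk0 _ hne, Units.ext ?_⟩
      change (⟨0, 1⟩ : E) ^ 2 = algebraMap F E a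
      rw [sq]
      refine QuadraticAlgebra.ext ?_ ?_
      · change (0 : F) * 0 + a * 1 * 1 = a
        ring
      · change (0 : F) * 1 + 1 * 0 + 0 * 1 * 1 = 0
        ring
    have haSF : a ∉ SF := fun ⟨c, hc⟩ => ha ⟨c, by rw [← hc, ← sq]; rfl⟩
    refine Subgroup.relIndex_eq_two_iff.2 ⟨a, haT, ?_⟩
    rintro c ⟨z, hz⟩
    have hz' : (z : E) * z = algebraMap F E c := by
      rw [← sq]; exact congrArg Units.val hz
    have hre : (z : E).re * (z : E).re + a * (z : E).im * (z : E).im = c :=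
      congrArg QuadraticAlgebra.re hz'
    have him : (z : E).re * (z : E).im + (z : E).im * (z : E).re + 0 * (z : E).im * (z : E).im = 0 :=
      congrArg QuadraticAlgebra.im hz'
    have h0 : (z : E).re = 0 ∨ (z : E).im = 0 := by
      have : (2 : F) * ((z : E).re * (z : E).im) = 0 := by linear_combination him
      simpa using this
    have key : c ∈ SF ∨ c * a ∈ SF := by
      rcases h0 with h | h
      · right
        have hne : a * (z : E).im ≠ 0 := fun h1 => c.ne_zero (by
          rw [← hre, h, h1]; ring)
        refine ⟨Units.mk0 _ hne, Units.ext ?_⟩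
        change (a * (z : E).im) ^ 2 = c * a
        rw [← hre, h]; ring
      · left
        have hne : (z : E).re ≠ 0 := fun h1 => c.ne_zero (by
          rw [← hre, h, h1]; ring)
        refine ⟨Units.mk0 _ hne, Units.ext ?_⟩
        change (z : E).re ^ 2 = c
        rw [← hre, h]; ring
    by_cases hc : c ∈ SF
    · simp [Xor, hc, SF.mul_mem_cancel_left hc, haSF]
    · simp [Xor, hc, key.resolve_left hc]
  have hSFT : SF ≤ SE.comap ι := by
    rintro _ ⟨c, rfl⟩
    exact ⟨ι c, (map_pow ι c 2).symm⟩
  have hSFN : SF ≤ normGroup a := by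
    rintro _ ⟨c, rfl⟩
    exact sq_mem_normGroup a c
  have e1 := Subgroup.relIndex_mul_index hSFN
  rw [← hrange, ← Subgroup.index_comap, hcomap, hrange, hF] at e1
  have e2 := Subgroup.relIndex_mul_index (le_sup_left : SE ≤ SE ⊔ ι.range)
  rw [sup_comm, Subgroup.relIndex_sup_right, ← Subgroup.index_comap, sup_comm, hE, hfin] at e2
  have e3 := Subgroup.relIndex_mul_index hSFT
  rw [hT, hF] at e3
  have e4 : (SE.comap ι).index = 2 * 2 ^ Module.finrank ℚ_[2] F := by omega
  have hpos : 0 < 2 ^ Module.finrank ℚ_[2] F := by positivity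
  rw [e4, pow_mul] at e2
  generalize 2 ^ Module.finrank ℚ_[2] F = q at *
  have e5 : (SE ⊔ ι.range).index = 2 * q :=
    Nat.eq_of_mul_eq_mul_left (by positivity : 0 < 2 * q) (by rw [e2]; ring)
  rw [e5] at e1
  exact Nat.eq_of_mul_eq_mul_left (by positivity : 0 < 2 * q) (by rw [e1]; ring)

end NormGroup

section DiagonalForms

open QuadraticMap

variable [Field F]

/-- The nondegenerate diagonal form with the given unit weights. -/
def diagForm {n : ℕ} (w : Fin n → Fˣ) : QuadraticMap F (Fin n → F) F :=
  diagQF n fun i => (w i : F)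

lemma diagForm_apply {n : ℕ} (w : Fin n → Fˣ) (x : Fin n → F) :
    diagForm w x = ∑ i, (w i : F) * (x i * x i) := by
  simp [diagForm, diagQF, weightedSumSquares_apply]

lemma diagForm_cons {n : ℕ} (c : Fˣ) (w : Fin n → Fˣ) (x : Fin (n + 1) → F) :
    diagForm (Fin.cons c w) x = c * (x 0 * x 0) + diagForm w (Fin.tail x) := by
  simp [diagForm_apply, Fin.sum_univ_succ, Fin.tail]

lemma polar_diagForm {n : ℕ} (w : Fin n → Fˣ) (x y : Fin n → F) :
    polar (diagForm w) x y = 2 * ∑ i, (w i : F) * (x i * y i) := by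
  simp only [polar, diagForm_apply, Pi.add_apply, Finset.mul_sum, ← Finset.sum_sub_distrib]
  exact Finset.sum_congr rfl fun i _ => by ring

lemma polar_diagForm_single {n : ℕ} (w : Fin n → Fˣ) (x : Fin n → F) (i : Fin n) :
    polar (diagForm w) x (Pi.single i 1) = 2 * (w i * x i) := by
  simp [polar_diagForm, Pi.single_apply]

lemma polar_map_isometry {M N : Type*} [AddCommGroup M] [Module F M] [AddCommGroup N] [Module F N]
    {Q : QuadraticMap F M F} {Q' : QuadraticMap F N F} (f : Q →qᵢ Q') (x y : M) :
    polar Q' (f x) (f y) = polar Q x y := by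
  simp only [polar, ← map_add, f.map_app]

lemma isometry_diagForm_injective [NeZero (2 : F)] {N : Type*} [AddCommGroup N] [Module F N]
    {n : ℕ} {w : Fin n → Fˣ} {Q : QuadraticMap F N F} (f : diagForm w →qᵢ Q) :
    Function.Injective f := by
  refine (injective_iff_map_eq_zero f).2 fun x hx => funext fun i => ?_
  have h := polar_map_isometry f x (Pi.single i 1)
  rw [hx, polar_zero_left, polar_diagForm_single] at h
  simpa [two_ne_zero] using h.symm

/-- The diagonal form with weights `v` represents the one with weights `w`. -/
def DiagRep {m n : ℕ} (v : Fin m → Fˣ) (w : Fin n → Fˣ) : Prop :=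
  Nonempty (diagForm w →qᵢ diagForm v)

lemma DiagRep.trans {l m n : ℕ} {u : Fin l → Fˣ} {v : Fin m → Fˣ} {w : Fin n → Fˣ}
    (h : DiagRep u v) (h' : DiagRep v w) : DiagRep u w :=
  h.elim fun f => h'.elim fun g => ⟨f.comp g⟩

lemma DiagRep.equivalent [NeZero (2 : F)] {n : ℕ} {v w : Fin n → Fˣ} (h : DiagRep v w) :
    (diagForm w).Equivalent (diagForm v) := by
  obtain ⟨f⟩ := h
  exact ⟨{ LinearEquiv.ofInjectiveEndo f.toLinearMap (isometry_diagForm_injective f) with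
    map_app' := f.map_app }⟩

lemma DiagRep.symm [NeZero (2 : F)] {n : ℕ} {v w : Fin n → Fˣ} (h : DiagRep v w) : DiagRep w v :=
  h.equivalent.symm.elim fun f => ⟨f.toIsometry⟩

lemma diagRep_of_sq {n : ℕ} {v w t : Fin n → Fˣ} (h : ∀ i, w i = v i * t i ^ 2) : DiagRep v w := by
  refine ⟨⟨LinearMap.pi fun i => (t i : F) • LinearMap.proj i, fun x => ?_⟩⟩
  simp only [AddHom.toFun_eq_coe, LinearMap.coe_toAddHom, diagForm_apply, h]
  exact Finset.sum_congr rfl fun i _ => by simp; ring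

lemma DiagRep.cons {m n : ℕ} {v : Fin m → Fˣ} {w : Fin n → Fˣ} (c : Fˣ) (h : DiagRep v w) :
    DiagRep (Fin.cons c v) (Fin.cons c w) := by
  obtain ⟨f⟩ := h
  refine ⟨⟨⟨⟨fun x => Fin.cons (x 0) (f (Fin.tail x)), fun x y => ?_⟩, fun a x => ?_⟩,
    fun x => ?_⟩⟩
  · refine funext (Fin.cases rfl fun i => ?_)
    have : Fin.tail (x + y) = Fin.tail x + Fin.tail y := rfl
    simp [this]
  · refine funext (Fin.cases rfl fun i => ?_)
    have : Fin.tail (a • x) = a • Fin.tail x := rfl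
    simp [this]
  · simp [diagForm_cons]

lemma diagRep_swap {n : ℕ} (a b : Fˣ) (w : Fin n → Fˣ) :
    DiagRep (Fin.cons a (Fin.cons b w) : Fin (n + 2) → Fˣ) (Fin.cons b (Fin.cons a w)) := by
  refine ⟨⟨LinearMap.funLeft F F (Equiv.swap 0 1), fun x => ?_⟩⟩
  have h : ∀ i : Fin n, (Equiv.swap 0 1 : Equiv.Perm (Fin (n + 2))) i.succ.succ = i.succ.succ :=
    fun i => Equiv.swap_apply_of_ne_of_ne (Fin.succ_ne_zero _)
      fun h => Fin.succ_ne_zero i (Fin.succ_injective _ h)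
  simp [diagForm_apply, Fin.sum_univ_succ, LinearMap.funLeft_apply, h]
  ring

/-- The reflection in the hyperplane orthogonal to an anisotropic vector. -/
def reflectionIsometry {M : Type*} [AddCommGroup M] [Module F M] (Q : QuadraticMap F M F) (u : M)
    (hu : Q u ≠ 0) : Q →qᵢ Q where
  toLinearMap := LinearMap.id - ((Q u)⁻¹ • Q.polarBilin u).smulRight u
  map_app' x := by
    simp only [AddHom.toFun_eq_coe, LinearMap.coe_toAddHom, LinearMap.sub_apply, LinearMap.id_apply,
      LinearMap.smulRight_apply, LinearMap.smul_apply, polarBilin_apply_apply, smul_eq_mul]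
    rw [sub_eq_add_neg, ← neg_smul, QuadraticMap.map_add Q, QuadraticMap.map_smul, polar_smul_right,
      polar_comm Q x u]
    simp only [smul_eq_mul]
    field_simp
    ring

lemma reflectionIsometry_apply {M : Type*} [AddCommGroup M] [Module F M] (Q : QuadraticMap F M F)
    (u : M) (hu : Q u ≠ 0) (x : M) :
    reflectionIsometry Q u hu x = x - ((Q u)⁻¹ * polar Q u x) • u := rfl

lemma exists_isometry_map_eq [NeZero (2 : F)] {M : Type*} [AddCommGroup M] [Module F M]
    (Q : QuadraticMap F M F) {x y : M} (h : Q x = Q y) (hx : Q x ≠ 0) :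
    ∃ σ : Q →qᵢ Q, σ x = y := by
  have hsub : Q (x - y) = 2 * Q x - polar Q x y := by
    rw [sub_eq_add_neg, QuadraticMap.map_add Q, polar_neg_right, QuadraticMap.map_neg, ← h]; ring
  have hadd : Q (x + y) = 2 * Q x + polar Q x y := by
    rw [QuadraticMap.map_add Q, ← h]; ring
  by_cases h0 : Q (x - y) = 0
  · have h1 : Q (x + y) ≠ 0 := by
      rw [h0] at hsub
      rw [hadd, ← sub_eq_zero.1 hsub.symm, ← two_mul, ← mul_assoc]
      exact mul_ne_zero (mul_ne_zero two_ne_zero two_ne_zero) hx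
    have hp : polar Q (x + y) x = Q (x + y) := by
      rw [polar_add_left, polar_self, hadd, polar_comm Q y x]; simp
    refine ⟨QuadraticMap.Isometry.comp ⟨-LinearMap.id, fun z => ?_⟩ (reflectionIsometry Q _ h1), ?_⟩
    · exact QuadraticMap.map_neg Q z
    · change -(reflectionIsometry Q _ h1 x) = y
      rw [reflectionIsometry_apply, hp, inv_mul_cancel₀ h1]
      simp
  · have hp : polar Q (x - y) x = Q (x - y) := by
      rw [polar_sub_left, polar_self, hsub, polar_comm Q y x]; simp
    refine ⟨reflectionIsometry Q _ h0, ?_⟩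
    rw [reflectionIsometry_apply, hp, inv_mul_cancel₀ h0]
    simp

lemma DiagRep.of_cons [NeZero (2 : F)] {m n : ℕ} {v : Fin m → Fˣ} {w : Fin n → Fˣ} {c : Fˣ}
    (h : DiagRep (Fin.cons c v : Fin (m + 1) → Fˣ) (Fin.cons c w : Fin (n + 1) → Fˣ)) : DiagRep v w := by
  obtain ⟨f⟩ := h
  obtain ⟨σ, hσ⟩ := exists_isometry_map_eq (diagForm (Fin.cons c v : Fin (m + 1) → Fˣ))
    (x := f (Pi.single 0 1)) (y := Pi.single 0 1)
    (by simp [diagForm_apply, Fin.sum_univ_succ]) (by simp [diagForm_apply, Fin.sum_univ_succ])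
  have h0 : ∀ x : Fin n → F, σ (f (Fin.cons 0 x)) 0 = 0 := fun x => by
    have h := polar_map_isometry (σ.comp f) (Fin.cons 0 x) (Pi.single 0 1)
    change polar _ (σ (f _)) (σ (f _)) = _ at h
    rw [hσ, polar_diagForm_single, polar_diagForm_single] at h
    simpa [two_ne_zero] using h
  refine ⟨⟨⟨⟨fun x => Fin.tail (σ (f (Fin.cons 0 x))), fun x y => ?_⟩, fun a x => ?_⟩,
    fun x => ?_⟩⟩
  · have : (Fin.cons 0 (x + y) : Fin (n + 1) → F) = Fin.cons 0 x + Fin.cons 0 y :=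
      funext (Fin.cases (by simp) fun i => by simp)
    change Fin.tail (σ (f (Fin.cons 0 (x + y)))) = _
    rw [this, map_add, map_add]; rfl
  · have : (Fin.cons 0 (a • x) : Fin (n + 1) → F) = a • Fin.cons 0 x :=
      funext (Fin.cases (by simp) fun i => by simp)
    change Fin.tail (σ (f (Fin.cons 0 (a • x)))) = a • Fin.tail (σ (f (Fin.cons 0 x)))
    rw [this, map_smul, map_smul]; rfl
  · have h := (σ.comp f).map_app (Fin.cons 0 x)
    change diagForm _ (σ (f _)) = _ at h
    rw [diagForm_cons, diagForm_cons, h0] at h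
    simpa using h

lemma exists_diagRep_cons_of_eq [NeZero (2 : F)] {n : ℕ} {v : Fin (n + 1) → Fˣ} {c : Fˣ}
    {x : Fin (n + 1) → F} (hx : diagForm v x = c) :
    ∃ w : Fin n → Fˣ, DiagRep v (Fin.cons c w) := by
  have : Invertible (2 : F) := invertibleOfNonzero two_ne_zero
  set Q := diagForm v
  set H := LinearMap.ker (Q.polarBilin x)
  have hself : Q.polarBilin x x = 2 * c := by simp [polar_self, hx]
  have h2c : (2 * c : F) ≠ 0 := mul_ne_zero two_ne_zero c.ne_zero
  have hfin : Module.finrank F H = n := by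
    have := Module.Dual.finrank_ker_add_one_of_ne_zero (f := Q.polarBilin x)
      fun h => h2c (by rw [← hself, h]; rfl)
    simpa using this
  have hsep : (associated (R := F) (Q.comp H.subtype)).SeparatingLeft := by
    intro y hy
    have hy' : ∀ z, polar Q y z = 0 := fun z => by
      have hz : z - (polar Q x z / (2 * c)) • x ∈ H := by
        rw [LinearMap.mem_ker, map_sub, map_smul, hself]
        simp [h2c]
      have h1 := hy ⟨_, hz⟩
      have h2 : polar Q y (z - (polar Q x z / (2 * c)) • x) = 0 := by
        have : polar (Q.comp H.subtype) y ⟨_, hz⟩ = 0 := by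
          rw [← polarBilin_apply_apply, ← two_nsmul_associated F, LinearMap.smul_apply, LinearMap.smul_apply, h1, smul_zero]
        exact this
      have h3 : polar Q y x = 0 := by rw [polar_comm]; exact y.2
      rwa [polar_sub_right, polar_smul_right, h3, smul_zero, sub_zero] at h2
    refine Subtype.ext (funext fun i => ?_)
    have := hy' (Pi.single i 1)
    rw [polar_diagForm_single] at this
    simpa [two_ne_zero] using this
  have hex := QuadraticForm.equivalent_weightedSumSquares_units_of_nondegenerate' _ hsep
  rw [hfin] at hex
  obtain ⟨w, ⟨e⟩⟩ := hex
  refine ⟨w, ⟨⟨(LinearMap.proj 0).smulRight x +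
    H.subtype ∘ₗ (e.symm.toLinearEquiv : (Fin n → F) →ₗ[F] H) ∘ₗ
      LinearMap.funLeft F F Fin.succ, fun y => ?_⟩⟩⟩
  have h1 : polar Q x (e.symm (Fin.tail y)) = 0 := (e.symm (Fin.tail y)).2
  have h2 : Q (e.symm (Fin.tail y)) = diagForm w (Fin.tail y) := by
    refine (e.symm.map_app (Fin.tail y)).trans ?_
    simp [diagForm_apply, weightedSumSquares_apply, Units.smul_def]
  change Q (y 0 • x + e.symm (Fin.tail y)) = _
  rw [QuadraticMap.map_add Q, polar_smul_left, h1, QuadraticMap.map_smul, hx, h2, diagForm_cons]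
  simp; ring

lemma DiagRep.exists_prod_eq [NeZero (2 : F)] {n : ℕ} {v w : Fin n → Fˣ} (h : DiagRep v w) :
    ∃ t : Fˣ, ∏ i, w i = (∏ i, v i) * t ^ 2 := by
  have : Invertible (2 : F) := invertibleOfNonzero two_ne_zero
  obtain ⟨f⟩ := h
  have hdiscr : ∀ w : Fin n → Fˣ, QuadraticForm.discr' (diagForm w) = ∏ i, (w i : F) := fun w => by
    have : QuadraticForm.toMatrix' (diagForm w) = Matrix.diagonal fun i => (w i : F) := by
      ext i j
      rw [QuadraticForm.toMatrix', LinearMap.toMatrix₂'_apply, associated_apply,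
        ← QuadraticMap.polar, polar_diagForm_single, Matrix.diagonal_apply]
      by_cases hij : i = j
      · rw [if_pos hij, Module.End.smul_def, half_moduleEnd_apply_eq_half_smul]
        simp [hij, two_ne_zero]
      · simp [hij, Ne.symm hij]
    rw [QuadraticForm.discr', this, Matrix.det_diagonal]
  have hcomp : (diagForm v).comp f.toLinearMap = diagForm w := QuadraticMap.ext f.map_app
  have h := QuadraticForm.discr'_comp (Q := diagForm v) f.toLinearMap
  rw [hcomp, hdiscr, hdiscr] at h
  have ht : f.toLinearMap.toMatrix'.det ≠ 0 := fun h0 => by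
    rw [h0, zero_mul, zero_mul, Finset.prod_eq_zero_iff] at h
    obtain ⟨i, -, hi⟩ := h
    exact (w i).ne_zero hi
  refine ⟨Units.mk0 _ ht, Units.ext ?_⟩
  push_cast
  rw [h, Units.val_mk0]; ring

end DiagonalForms

section NormGroupProperties

variable [Field F]

lemma normGroup_of_isSquare [NeZero (2 : F)] {a : Fˣ} (h : IsSquare a) : normGroup a = ⊤ := by
  obtain ⟨s, rfl⟩ := h
  refine eq_top_iff.2 fun c _ => ⟨(c + 1) / 2, (c - 1) / (2 * s), ?_⟩
  have h2 : (2 : F) ≠ 0 := two_ne_zero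
  push_cast
  field_simp
  ring

lemma normGroup_mul_sq (a t : Fˣ) : normGroup (a * t ^ 2) = normGroup a := by
  ext c
  simp only [mem_normGroup]
  constructor
  · rintro ⟨x, y, h⟩
    exact ⟨x, t * y, by rw [h]; push_cast; ring⟩
  · rintro ⟨x, y, h⟩
    exact ⟨x, y / t, by rw [h]; push_cast; field_simp⟩

lemma mem_normGroup_symm [NeZero (2 : F)] {a c : Fˣ} (h : c ∈ normGroup a) :
    a ∈ normGroup c := by
  obtain ⟨x, y, hxy⟩ := h
  by_cases hy : y = 0
  · have hx : x ≠ 0 := fun h0 => c.ne_zero (by rw [hxy, hy, h0]; simp)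
    have hc : IsSquare c := ⟨Units.mk0 x hx, Units.ext (by simp [hxy, hy, sq])⟩
    rw [normGroup_of_isSquare hc]
    trivial
  · refine ⟨x / y, 1 / y, ?_⟩
    rw [hxy]
    field_simp
    ring

lemma mem_normGroup_comm [NeZero (2 : F)] {a c : Fˣ} : c ∈ normGroup a ↔ a ∈ normGroup c :=
  ⟨mem_normGroup_symm, mem_normGroup_symm⟩

/-- The group of square classes. -/
def SquareClasses (F : Type*) [Field F] : Type _ := Fˣ ⧸ (powMonoidHom 2 : Fˣ →* Fˣ).range

instance : CommGroup (SquareClasses F) :=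
  inferInstanceAs (CommGroup (Fˣ ⧸ (powMonoidHom 2 : Fˣ →* Fˣ).range))

/-- The square class of a unit. -/
def sqClass : Fˣ →* SquareClasses F :=
  (QuotientGroup.mk' _ : Fˣ →* Fˣ ⧸ (powMonoidHom 2 : Fˣ →* Fˣ).range)

lemma sqClass_surjective : Function.Surjective (sqClass (F := F)) := QuotientGroup.mk_surjective

lemma sqClass_eq_iff {a b : Fˣ} : sqClass a = sqClass b ↔ ∃ t, a = b * t ^ 2 := by
  rw [eq_comm]
  refine QuotientGroup.eq.trans ⟨?_, ?_⟩
  · rintro ⟨t, ht⟩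
    refine ⟨t, ?_⟩
    rw [show t ^ 2 = b⁻¹ * a from ht, mul_inv_cancel_left]
  · rintro ⟨t, rfl⟩
    exact ⟨t, by simp⟩

lemma isSquare_iff_sqClass {a : Fˣ} : IsSquare a ↔ sqClass a = 1 := by
  rw [← map_one sqClass, sqClass_eq_iff]
  simp [isSquare_iff_exists_sq]

lemma sqClass_mul_self (a : Fˣ) : sqClass a * sqClass a = 1 := by
  rw [← map_mul, ← isSquare_iff_sqClass]
  exact ⟨a, rfl⟩

lemma DiagRep.sqClass_prod_eq [NeZero (2 : F)] {n : ℕ} {v w : Fin n → Fˣ} (h : DiagRep v w) :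
    sqClass (∏ i, w i) = sqClass (∏ i, v i) :=
  sqClass_eq_iff.2 h.exists_prod_eq

lemma diagRep_cons_of_sqClass_eq {n : ℕ} {a b : Fˣ} (h : sqClass a = sqClass b) (w : Fin n → Fˣ) :
    DiagRep (Fin.cons b w : Fin (n + 1) → Fˣ) (Fin.cons a w) := by
  obtain ⟨t, rfl⟩ := sqClass_eq_iff.1 h
  exact diagRep_of_sq (t := Fin.cons t 1) (Fin.cases (by simp) fun i => by simp)

lemma exists_diagForm_eq_of_isotropic [NeZero (2 : F)] {n : ℕ} {v : Fin n → Fˣ} {z : Fin n → F}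
    (hz : z ≠ 0) (h : diagForm v z = 0) (c : F) : ∃ x, diagForm v x = c := by
  obtain ⟨i, hi⟩ := Function.ne_iff.1 hz
  have hi : z i ≠ 0 := hi
  have h2 : (2 : F) ≠ 0 := two_ne_zero
  have hv : diagForm v (Pi.single i 1) = v i := by
    simp [diagForm_apply, Pi.single_apply]
  refine ⟨((c - v i) / (2 * (v i * z i))) • z + Pi.single i 1, ?_⟩
  rw [QuadraticMap.map_add (diagForm v), QuadraticMap.map_smul, h, hv, QuadraticMap.polar_smul_left,
    polar_diagForm_single]
  have := (v i).ne_zero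
  simp only [smul_eq_mul]
  field_simp
  ring

lemma exists_diagForm_eq_of_mem_normGroup {w : Fin 2 → Fˣ} {c : Fˣ}
    (h : c * w 0 ∈ normGroup (-(w 0 * w 1))) : ∃ x, diagForm w x = c := by
  obtain ⟨x, y, h⟩ := h
  push_cast at h
  refine ⟨![x / w 0, y], ?_⟩
  have := (w 0).ne_zero
  simp only [diagForm_apply, Fin.sum_univ_two, Matrix.cons_val_zero, Matrix.cons_val_one]
  field_simp
  linear_combination -h

lemma DiagRep.exists_diagForm_eq {m n : ℕ} {v : Fin m → Fˣ} {c : Fˣ} {w : Fin n → Fˣ}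
    (h : DiagRep v (Fin.cons c w)) : ∃ x, diagForm v x = c := by
  obtain ⟨f⟩ := h
  exact ⟨f (Pi.single 0 1), by
    rw [f.map_app]; simp [diagForm_apply, Fin.sum_univ_succ]⟩

lemma DiagRep.exists_cons [NeZero (2 : F)] {m n : ℕ} {v : Fin m → Fˣ} {w : Fin n → Fˣ}
    (h : DiagRep v w) (hmn : n < m) : ∃ c : Fˣ, DiagRep v (Fin.cons c w : Fin (n + 1) → Fˣ) := by
  induction n generalizing m with
  | zero =>
    obtain ⟨m, rfl⟩ := Nat.exists_eq_succ_of_ne_zero hmn.ne'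
    refine ⟨v 0, ?_⟩
    have h0 : DiagRep (Fin.tail v) w := ⟨⟨0, fun x => by simp [diagForm_apply]⟩⟩
    simpa using h0.cons (v 0)
  | succ n ih =>
    obtain ⟨m, rfl⟩ := Nat.exists_eq_succ_of_ne_zero (Nat.ne_zero_of_lt hmn)
    obtain ⟨a, w, rfl⟩ : ∃ a w', w = Fin.cons a w' := ⟨w 0, Fin.tail w, by simp⟩
    obtain ⟨x, hx⟩ := h.exists_diagForm_eq
    obtain ⟨v', hv'⟩ := exists_diagRep_cons_of_eq hx
    obtain ⟨c, hc⟩ := ih (hv'.symm.trans h).of_cons (by omega)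
    exact ⟨c, (hv'.trans (hc.cons a)).trans (diagRep_swap a c w)⟩

lemma diagRep_tail {n : ℕ} (c : Fˣ) (w : Fin n → Fˣ) :
    DiagRep (Fin.cons c w : Fin (n + 1) → Fˣ) w := by
  refine ⟨⟨⟨⟨fun x => Fin.cons 0 x, fun x y => ?_⟩, fun a x => ?_⟩, fun x => ?_⟩⟩
  · exact funext (Fin.cases (by simp) fun i => by simp)
  · exact funext (Fin.cases (by simp) fun i => by simp)
  · simp [diagForm_cons]

/-- A binary form of determinant `-1` is hyperbolic. -/
lemma diagRep_hyperbolic [NeZero (2 : F)] {n : ℕ} {a b : Fˣ} (h : sqClass (a * b) = sqClass (-1))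
    (w : Fin n → Fˣ) :
    DiagRep (Fin.cons 1 (Fin.cons (-1) w) : Fin (n + 2) → Fˣ) (Fin.cons a (Fin.cons b w)) := by
  obtain ⟨t, ht⟩ := sqClass_eq_iff.1 h
  have ht' : (a * b : F) = -(t ^ 2) := by simpa using congrArg Units.val ht
  have h2 : (2 : F) ≠ 0 := two_ne_zero
  let f₀ : (Fin (n + 2) → F) →ₗ[F] F :=
    ((a + 1) / 2 : F) • LinearMap.proj 0 + ((a - 1) * t / (2 * a) : F) • LinearMap.proj 1
  let f₁ : (Fin (n + 2) → F) →ₗ[F] F :=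
    ((a - 1) / 2 : F) • LinearMap.proj 0 + ((a + 1) * t / (2 * a) : F) • LinearMap.proj 1
  refine ⟨⟨LinearMap.pi (Fin.cons f₀ (Fin.cons f₁ fun i => LinearMap.proj i.succ.succ)),
    fun x => ?_⟩⟩
  have ha := a.ne_zero
  have hb : (b : F) = -(t ^ 2) / a := by rw [← ht']; field_simp
  simp [diagForm_apply, Fin.sum_univ_succ, f₀, f₁, hb]
  field_simp
  ring

lemma neZero_two_of_padic (K : Type*) [Field K] [Algebra ℚ_[2] K] : NeZero (2 : K) :=
  have : CharZero K := charZero_of_injective_algebraMap (algebraMap ℚ_[2] K).injective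
  ⟨two_ne_zero⟩

end NormGroupProperties

section LocalClassification

variable [Field F] [Algebra ℚ_[2] F] [FiniteDimensional ℚ_[2] F]

lemma mul_mem_normGroup_of_notMem {a c d : Fˣ} (hc : c ∉ normGroup a) (hd : d ∉ normGroup a) :
    c * d ∈ normGroup a := by
  have := neZero_two_of_padic F
  by_cases ha : IsSquare a
  · rw [normGroup_of_isSquare ha]; trivial
  · simp [Subgroup.mul_mem_iff_of_index_two (index_normGroup ha), hc, hd]

lemma exists_notMem_normGroup {a : Fˣ} (ha : ¬ IsSquare a) : ∃ c, c ∉ normGroup a := by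
  by_contra! h
  have := index_normGroup ha
  rw [(eq_top_iff.2 fun c _ => h c : normGroup a = ⊤)] at this
  simp at this

lemma exists_mul_mem_normGroup {p q : Fˣ} (h : ¬ IsSquare (p * q)) (r : Fˣ) :
    ∃ k ∈ normGroup q, r * k ∈ normGroup p := by
  have := neZero_two_of_padic F
  by_cases hr : r ∈ normGroup p
  · exact ⟨1, one_mem _, by simpa⟩
  by_contra! hk
  have hle : ∀ k ∈ normGroup q, k ∈ normGroup p := fun k hkq => by
    by_contra hkp
    exact hk k hkq (mul_mem_normGroup_of_notMem hr hkp)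
  obtain ⟨c, hc⟩ := exists_notMem_normGroup h
  apply hc
  rw [mem_normGroup_comm]
  by_cases hcq : c ∈ normGroup q
  · exact mul_mem (mem_normGroup_symm (hle c hcq)) (mem_normGroup_symm hcq)
  · have hrq : r ∉ normGroup q := fun h => hr (hle r h)
    have hcp : c ∉ normGroup p := fun h =>
      hr ((Subgroup.mul_mem_cancel_left _ h).1 (hle _ (mul_mem_normGroup_of_notMem hcq hrq)))
    exact mul_mem_normGroup_of_notMem (fun h => hcp (mem_normGroup_symm h))
      fun h => hcq (mem_normGroup_symm h)

/-- A form with at least three variables represents every `c` such that `-c` times the product of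
three of the weights is not a square. -/
lemma exists_diagForm_eq_of_not_isSquare {m : ℕ} (v : Fin (m + 3) → Fˣ) {c : Fˣ}
    (h : ¬ IsSquare (c * -(v 0 * v 1 * v 2))) : ∃ x, diagForm v x = c := by
  have := neZero_two_of_padic F
  obtain ⟨k, ⟨t, z, htz⟩, ⟨x, y, hxy⟩⟩ := exists_mul_mem_normGroup (p := -(v 0 * v 1))
    (q := c * v 2) (by convert h using 1; rw [neg_mul, mul_neg, mul_left_comm, mul_assoc])
    (c * v 0)
  push_cast at htz hxy
  let X : Fin (m + 3) → F := Fin.cons (x / v 0) (Fin.cons y (Fin.cons (c * z) 0))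
  have hX : diagForm v X = c * t ^ 2 := by
    have h0 : diagForm v X = v 0 * (x / v 0) ^ 2 + v 1 * y ^ 2 + v 2 * (c * z) ^ 2 := by
      rw [diagForm_apply, Fin.sum_univ_succ, Fin.sum_univ_succ, Fin.sum_univ_succ]
      change v 0 * (x / v 0 * (x / v 0)) + (v 1 * (y * y) + (v 2 * (c * z * (c * z)) +
        ∑ i : Fin m, (v i.succ.succ.succ : F) * ((0 : F) * 0))) = _
      simp only [mul_zero, Finset.sum_const_zero]
      ring
    rw [h0]
    have := (v 0).ne_zero
    field_simp
    linear_combination -hxy + c * v 0 * htz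
  by_cases ht : t = 0
  · refine exists_diagForm_eq_of_isotropic (z := X) (fun hX0 => ?_) (by simp [hX, ht]) c
    have hx : x = 0 := by simpa [X] using congrFun hX0 0
    have hy : y = 0 := by simpa [X] using congrFun hX0 1
    rw [hx, hy] at hxy
    simp at hxy
  · refine ⟨t⁻¹ • X, ?_⟩
    rw [QuadraticMap.map_smul, hX, smul_eq_mul]
    field_simp

lemma exists_forall_not_isSquare_mul (k : Fin 3 → Fˣ) : ∃ c : Fˣ, ∀ i, ¬ IsSquare (c * k i) := by
  by_contra! h
  have hsurj : Function.Surjective fun i => (sqClass (k i) : SquareClasses F) := by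
    intro c
    obtain ⟨c, rfl⟩ := sqClass_surjective c
    obtain ⟨i, hi⟩ := h c
    refine ⟨i, ?_⟩
    rw [isSquare_iff_sqClass, map_mul] at hi
    exact (mul_left_cancel ((sqClass_mul_self c).trans hi.symm)).symm
  have h1 := Nat.card_le_card_of_surjective _ hsurj
  have h2 := index_squares_of_finiteDimensional_padic F
  have h3 := Nat.one_le_two_pow (n := Module.finrank ℚ_[2] F)
  change Nat.card (SquareClasses F) = _ at h2
  rw [h2, Nat.card_eq_fintype_card, Fintype.card_fin] at h1
  omega

/-- Diagonal forms of the same dimension and determinant fall into at most two classes. -/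
theorem exists_diagRep_of_three {m : ℕ} (w : Fin 3 → Fin (m + 2) → Fˣ) (d : SquareClasses F)
    (hd : ∀ i, sqClass (∏ j, w i j) = d) : ∃ i j, i ≠ j ∧ DiagRep (w i) (w j) := by
  have := neZero_two_of_padic F
  induction m generalizing d with
  | zero =>
    obtain ⟨D, rfl⟩ := sqClass_surjective d
    have hN : ∀ i, normGroup (-(w i 0 * w i 1)) = normGroup (-D) := fun i => by
      obtain ⟨t, ht⟩ := sqClass_eq_iff.1 (hd i)
      rw [Fin.prod_univ_two] at ht
      rw [ht, ← neg_mul, normGroup_mul_sq]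
    obtain ⟨i, j, hij, h⟩ := Fintype.exists_ne_map_eq_of_card_lt
      (fun i => w i 0 ∈ normGroup (-D)) (by simp)
    have hmem : w j 0 * w i 0 ∈ normGroup (-D) := by
      by_cases hi : w i 0 ∈ normGroup (-D)
      · exact mul_mem (h ▸ hi) hi
      · exact mul_mem_normGroup_of_notMem (fun hj => hi (h.symm ▸ hj)) hi
    rw [← hN i] at hmem
    obtain ⟨x, hx⟩ := exists_diagForm_eq_of_mem_normGroup hmem
    obtain ⟨b, hb⟩ := exists_diagRep_cons_of_eq hx
    refine ⟨i, j, hij, hb.trans ?_⟩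
    have hdet := hb.sqClass_prod_eq
    rw [hd i, ← hd j] at hdet
    replace hdet : sqClass (w j 0 * b 0) = sqClass (w j 0 * w j 1) := by
      rwa [Fin.prod_univ_two, Fin.prod_univ_two] at hdet
    rw [map_mul, map_mul] at hdet
    have hb1 := diagRep_cons_of_sqClass_eq (mul_left_cancel hdet).symm Fin.elim0
    convert hb1.cons (w j 0) using 1 <;> ext i <;> fin_cases i <;> rfl
  | succ m ih =>
    obtain ⟨c, hc⟩ := exists_forall_not_isSquare_mul fun i => -(w i 0 * w i 1 * w i 2)
    choose x hx using fun i => exists_diagForm_eq_of_not_isSquare (w i) (hc i)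
    choose w' hw' using fun i => exists_diagRep_cons_of_eq (hx i)
    obtain ⟨i, j, hij, h⟩ := ih w' (sqClass c * d) fun i => by
      rw [← hd i, ← (hw' i).sqClass_prod_eq, Fin.prod_cons, map_mul, ← mul_assoc,
        sqClass_mul_self, one_mul]
    exact ⟨i, j, hij, ((hw' i).trans (h.cons c)).trans (hw' j).symm⟩

lemma diagRep_or_of_not_diagRep {n : ℕ} (hn : 2 ≤ n) {u w₁ w₂ : Fin n → Fˣ}
    (h₁ : sqClass (∏ i, w₁ i) = sqClass (∏ i, u i))
    (h₂ : sqClass (∏ i, w₂ i) = sqClass (∏ i, u i)) (h : ¬ DiagRep w₁ w₂) :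
    DiagRep u w₁ ∨ DiagRep u w₂ := by
  have := neZero_two_of_padic F
  obtain ⟨m, rfl⟩ := Nat.exists_eq_add_of_le' hn
  obtain ⟨i, j, hij, hr⟩ := exists_diagRep_of_three ![u, w₁, w₂] (sqClass (∏ i, u i))
    (Fin.forall_fin_succ.2 ⟨rfl, Fin.forall_fin_two.2 ⟨h₁, h₂⟩⟩)
  have h' : ¬ DiagRep w₂ w₁ := fun h' => h h'.symm
  fin_cases i <;> fin_cases j <;> first
    | exact absurd rfl hij
    | exact absurd hr h
    | exact absurd hr h'
    | exact Or.inl hr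
    | exact Or.inr hr
    | exact Or.inl hr.symm
    | exact Or.inr hr.symm

theorem xor_diagRep_of_codim_one {n : ℕ} (hn : 1 ≤ n) {w₁ w₂ : Fin n → Fˣ}
    (hw : sqClass (∏ i, w₁ i) = sqClass (∏ i, w₂ i)) (h : ¬ DiagRep w₁ w₂)
    (u : Fin (n + 1) → Fˣ) : Xor (DiagRep u w₁) (DiagRep u w₂) := by
  have := neZero_two_of_padic F
  let e := (∏ i, u i) * ∏ i, w₂ i
  have key : ∀ w : Fin n → Fˣ, sqClass (∏ i, w i) = sqClass (∏ i, w₂ i) →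
      (DiagRep u w ↔ DiagRep u (Fin.cons e w : Fin (n + 1) → Fˣ)) := fun w hw => by
    refine ⟨fun hr => ?_, fun hr => hr.trans (diagRep_tail e w)⟩
    obtain ⟨c, hc⟩ := hr.exists_cons (Nat.lt_succ_self n)
    have hdet := hc.sqClass_prod_eq
    rw [Fin.prod_cons, map_mul, hw] at hdet
    refine hc.trans (diagRep_cons_of_sqClass_eq ?_ w)
    rw [map_mul, ← hdet, mul_assoc, sqClass_mul_self, mul_one]
  have hdet : ∀ w : Fin n → Fˣ, sqClass (∏ i, w i) = sqClass (∏ i, w₂ i) →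
      sqClass (∏ i, (Fin.cons e w : Fin (n + 1) → Fˣ) i) = sqClass (∏ i, u i) := fun w hw => by
    rw [Fin.prod_cons, map_mul, map_mul, hw, mul_assoc, sqClass_mul_self, mul_one]
  rw [key w₁ hw, key w₂ rfl, xor_iff_or_and_not_and]
  exact ⟨diagRep_or_of_not_diagRep (by omega) (hdet w₁ hw) (hdet w₂ rfl) fun hr => h hr.of_cons,
    fun hr => h (hr.1.symm.trans hr.2).of_cons⟩

theorem xor_diagRep_of_codim_two {n : ℕ} {w₁ w₂ : Fin n → Fˣ}
    (hw : sqClass (∏ i, w₁ i) = sqClass (∏ i, w₂ i)) (h : ¬ DiagRep w₁ w₂)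
    (u : Fin (n + 2) → Fˣ) (hu : sqClass (∏ i, u i) = sqClass (-∏ i, w₂ i)) :
    Xor (DiagRep u w₁) (DiagRep u w₂) := by
  have := neZero_two_of_padic F
  have key : ∀ w : Fin n → Fˣ, sqClass (∏ i, w i) = sqClass (∏ i, w₂ i) →
      (DiagRep u w ↔ DiagRep u (Fin.cons 1 (Fin.cons (-1) w) : Fin (n + 2) → Fˣ)) :=
    fun w hw => by
    refine ⟨fun hr => ?_, fun hr => (hr.trans (diagRep_tail _ _)).trans (diagRep_tail _ _)⟩
    obtain ⟨c, hc⟩ := hr.exists_cons (by omega)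
    obtain ⟨c', hc'⟩ := hc.exists_cons (by omega)
    have hdet := hc'.sqClass_prod_eq
    rw [Fin.prod_cons, Fin.prod_cons, hu, ← neg_one_mul, map_mul, map_mul, map_mul, hw,
      ← mul_assoc] at hdet
    exact hc'.trans (diagRep_hyperbolic (by rw [map_mul, mul_right_cancel hdet]) w).symm
  have hdet : ∀ w : Fin n → Fˣ, sqClass (∏ i, w i) = sqClass (∏ i, w₂ i) →
      sqClass (∏ i, (Fin.cons 1 (Fin.cons (-1) w) : Fin (n + 2) → Fˣ) i) = sqClass (∏ i, u i) :=
    fun w hw => by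
    rw [Fin.prod_cons, Fin.prod_cons, hu, ← neg_one_mul (∏ i, w₂ i), one_mul, map_mul, map_mul, hw]
  rw [key w₁ hw, key w₂ rfl, xor_iff_or_and_not_and]
  exact ⟨diagRep_or_of_not_diagRep (by omega) (hdet w₁ hw) (hdet w₂ rfl)
      fun hr => h hr.of_cons.of_cons,
    fun hr => h (hr.1.symm.trans hr.2).of_cons.of_cons⟩

end LocalClassification

/-- if `W₁ ≇ W₂` are `n`-dimensional spaces with the same determinant `D`,
and `V` has dimension `n+1`, or dimension `n+2` with determinant `-D`, then `V`
represents exactly one of `W₁`, `W₂`. -/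
theorem represents_exactly_one [Field F] [Algebra ℚ_[2] F] [FiniteDimensional ℚ_[2] F]
    (n : ℕ) (hn : 2 ≤ n) (W₁ W₂ : Fin n → F) (D : F)
    (hW₁ : ∀ i, W₁ i ≠ 0) (hW₂ : ∀ i, W₂ i ≠ 0)
    (hD₁ : ∃ t : F, t ≠ 0 ∧ (∏ i, W₁ i) = D * t ^ 2)
    (hD₂ : ∃ t : F, t ≠ 0 ∧ (∏ i, W₂ i) = D * t ^ 2)
    (hne : ¬ QuadraticMap.Equivalent (diagQF n W₁) (diagQF n W₂))
    (k : ℕ) (u : Fin k → F) (hu : ∀ i, u i ≠ 0)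
    (hdim : k = n + 1 ∨ (k = n + 2 ∧ ∃ t : F, t ≠ 0 ∧ (∏ i, u i) = -D * t ^ 2)) :
    Xor' (QRep (diagQF k u) (diagQF n W₁)) (QRep (diagQF k u) (diagQF n W₂)) := by
  have := neZero_two_of_padic F
  let units {n : ℕ} (w : Fin n → F) (hw : ∀ i, w i ≠ 0) : Fin n → Fˣ := fun i => Units.mk0 _ (hw i)
  have hprod : ∀ {n : ℕ} (w : Fin n → F) (hw : ∀ i, w i ≠ 0),
      ((∏ i, units w hw i : Fˣ) : F) = ∏ i, w i := fun w hw => by simp [units]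
  have hrep : ∀ {m n : ℕ} (v : Fin m → F) (hv : ∀ i, v i ≠ 0) (w : Fin n → F) (hw : ∀ i, w i ≠ 0),
      QRep (diagQF m v) (diagQF n w) ↔ DiagRep (units v hv) (units w hw) := fun v hv w hw =>
    ⟨fun ⟨f, _⟩ => ⟨f⟩, fun ⟨f⟩ => ⟨f, isometry_diagForm_injective (w := units w hw) f⟩⟩
  have hD : D ≠ 0 := by
    obtain ⟨t, -, h⟩ := hD₁
    rintro rfl
    rw [zero_mul] at h
    exact Finset.prod_ne_zero_iff.2 (fun i _ => hW₁ i) h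
  have hsq : ∀ (a : Fˣ) (b : F) (hb : b ≠ 0), (∃ t : F, t ≠ 0 ∧ (a : F) = b * t ^ 2) →
      sqClass a = sqClass (Units.mk0 b hb) := fun a b hb ⟨t, ht, h⟩ =>
    sqClass_eq_iff.2 ⟨Units.mk0 t ht, Units.ext (by simpa using h)⟩
  have h₁ := hsq (∏ i, units W₁ hW₁ i) D hD (by rwa [hprod])
  have h₂ := hsq (∏ i, units W₂ hW₂ i) D hD (by rwa [hprod])
  have hne' : ¬ DiagRep (units W₁ hW₁) (units W₂ hW₂) := fun h => hne h.symm.equivalent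
  rw [hrep u hu W₁ hW₁, hrep u hu W₂ hW₂]
  obtain rfl | ⟨rfl, hu'⟩ := hdim
  · exact xor_diagRep_of_codim_one (by omega) (h₁.trans h₂.symm) hne' _
  · refine xor_diagRep_of_codim_two (h₁.trans h₂.symm) hne' _ ?_
    rw [hsq (∏ i, units u hu i) (-D) (neg_ne_zero.2 hD) (by rwa [hprod]),
      ← neg_one_mul (∏ i, units W₂ hW₂ i), map_mul, h₂, ← map_mul]
    congr 1
    ext
    simp
end
end

section
/- Let F be a dyadic local field, n ≥ 2 even, μ ∈ {1, Δ}, and ε a unit of 𝒪_F. Then the space W₁^{n+1}(ε) = ℍ^{n/2} ⊥ [ε] represents W₁ⁿ(μ) = ℍ^{(n-2)/2} ⊥ [1,-μ] but does not represent W₂ⁿ(μ) (when the latter is defined). -/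
noncomputable section
open scoped Classical

variable {F : Type*}

namespace NormDiscValuation

/-- The order of a nonzero element as an integer (and `0` at `0`). -/
def ord [Field F] (V : NormDiscValuation F) (x : F) : ℤ := (V.v x).untopD 0

section Order

variable [Field F] (V : NormDiscValuation F)

lemma coe_ord {x : F} (hx : x ≠ 0) : (V.ord x : WithTop ℤ) = V.v x := by
  obtain ⟨k, hk⟩ := WithTop.ne_top_iff_exists.1 (V.v_ne_top x hx)
  simp [ord, ← hk]

lemma ord_eq {x : F} {k : ℤ} (h : V.v x = k) : V.ord x = k := by simp [ord, h]

lemma ne_zero_of_v_eq {x : F} {k : ℤ} (h : V.v x = k) : x ≠ 0 := by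
  rintro rfl
  simp [V.v_zero] at h

lemma ord_mul {x y : F} (hx : x ≠ 0) (hy : y ≠ 0) : V.ord (x * y) = V.ord x + V.ord y := by
  have h := V.v_mul x y
  rw [← V.coe_ord hx, ← V.coe_ord hy, ← V.coe_ord (mul_ne_zero hx hy)] at h
  exact_mod_cast h

lemma min_ord_le_ord_add {x y : F} (hx : x ≠ 0) (hy : y ≠ 0) (hxy : x + y ≠ 0) :
    min (V.ord x) (V.ord y) ≤ V.ord (x + y) := by
  have h := V.v_add x y
  rw [← V.coe_ord hx, ← V.coe_ord hy, ← V.coe_ord hxy] at h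
  exact_mod_cast h

@[simp] lemma ord_one : V.ord 1 = 0 := by
  have h := V.ord_mul (one_ne_zero (α := F)) one_ne_zero
  rw [mul_one] at h
  lia

@[simp] lemma ord_neg_one : V.ord (-1) = 0 := by
  have h := V.ord_mul (neg_ne_zero.2 (one_ne_zero (α := F))) (neg_ne_zero.2 one_ne_zero)
  rw [neg_mul_neg, mul_one, ord_one] at h
  lia

lemma ord_inv {x : F} (hx : x ≠ 0) : V.ord x⁻¹ = -V.ord x := by
  have h := V.ord_mul hx (inv_ne_zero hx)
  rw [mul_inv_cancel₀ hx, ord_one] at h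
  lia

lemma ord_pow {x : F} (hx : x ≠ 0) (k : ℕ) : V.ord (x ^ k) = k * V.ord x := by
  induction k with
  | zero => simp
  | succ k ih =>
    rw [pow_succ, V.ord_mul (pow_ne_zero k hx) hx, ih]
    push_cast
    ring

lemma ord_one_add_neg {x : F} (hx : x ≠ 0) (h : V.ord x < 0) : V.ord (1 + x) < 0 := by
  have h1 : 1 + x ≠ 0 := by
    intro h0
    rw [eq_neg_of_add_eq_zero_right h0, ord_neg_one] at h
    exact h.false
  have h2 := V.min_ord_le_ord_add h1 (neg_ne_zero.2 one_ne_zero) (by simpa using hx)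
  rw [add_neg_cancel_comm, ord_neg_one] at h2
  lia

end Order

end NormDiscValuation

section Normed

variable [NormedField F] [IsUltrametricDist F]

lemma norm_add_lt_one {x y : F} (hx : ‖x‖ < 1) (hy : ‖y‖ < 1) : ‖x + y‖ < 1 :=
  (IsUltrametricDist.norm_add_le_max x y).trans_lt (max_lt hx hy)

lemma norm_sub_lt_one {x y : F} (hx : ‖x‖ < 1) (hy : ‖y‖ < 1) : ‖x - y‖ < 1 := by
  rw [sub_eq_add_neg]
  exact norm_add_lt_one hx (by rwa [norm_neg])

lemma norm_sub_le_max' (x y : F) : ‖x - y‖ ≤ max ‖x‖ ‖y‖ := by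
  simpa [sub_eq_add_neg] using IsUltrametricDist.norm_add_le_max x (-y)

/-- Hensel's lemma for a cubic with unit linear coefficient. -/
lemma exists_add_sq_add_cube_eq [CompleteSpace F] {a b x : F} (ha : ‖a‖ ≤ 1) (hb : ‖b‖ ≤ 1)
    (hx : ‖x‖ < 1) : ∃ z : F, ‖z‖ < 1 ∧ z + a * z ^ 2 + b * z ^ 3 = x := by
  set r : NNReal := ⟨‖x‖, norm_nonneg x⟩
  set T : F → F := fun z => x - a * z ^ 2 - b * z ^ 3 with hT
  set s : Set F := {z | ‖z‖ ≤ r}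
  have hsc : IsComplete s := by
    refine IsClosed.isComplete ?_
    exact isClosed_le continuous_norm continuous_const
  have hr1 : (r : ℝ) < 1 := hx
  have hsub : ∀ u v : F, ‖u‖ ≤ r → ‖v‖ ≤ r → ‖u - v‖ ≤ r := fun u v hu hv =>
    (norm_sub_le_max' u v).trans (max_le hu hv)
  have hadd : ∀ u v : F, ‖u‖ ≤ r → ‖v‖ ≤ r → ‖u + v‖ ≤ r := fun u v hu hv =>
    (IsUltrametricDist.norm_add_le_max u v).trans (max_le hu hv)
  have hmul : ∀ u v : F, ‖u‖ ≤ 1 → ‖v‖ ≤ r → ‖u * v‖ ≤ r := fun u v hu hv => by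
    rw [norm_mul]
    nlinarith [norm_nonneg u, norm_nonneg v]
  have hmaps : Set.MapsTo T s s := by
    intro z hz
    have hz1 : ‖z‖ ≤ 1 := le_trans hz hr1.le
    refine hsub _ _ (hsub _ _ le_rfl (hmul _ _ ha ?_)) (hmul _ _ hb ?_)
    · rw [sq]; exact hmul _ _ hz1 hz
    · rw [pow_succ, sq, mul_assoc]; exact hmul _ _ hz1 (hmul _ _ hz1 hz)
  have hcon : ContractingWith r (hmaps.restrict T s s) := by
    refine ⟨by exact_mod_cast hr1, LipschitzWith.of_dist_le_mul ?_⟩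
    rintro ⟨z, hz⟩ ⟨w, hw⟩
    have hz1 : ‖z‖ ≤ 1 := le_trans hz hr1.le
    have hw1 : ‖w‖ ≤ 1 := le_trans hw hr1.le
    change dist (T z) (T w) ≤ r * dist z w
    rw [dist_eq_norm, dist_eq_norm]
    have : T z - T w = (a * (z + w) + b * (z * z + z * w + w * w)) * (w - z) := by
      simp only [hT]; ring
    rw [this, norm_mul, norm_sub_rev w z]
    refine mul_le_mul_of_nonneg_right ?_ (norm_nonneg _)
    exact hadd _ _ (hmul _ _ ha (hadd _ _ hz hw))
      (hmul _ _ hb (hadd _ _ (hadd _ _ (hmul _ _ hz1 hz) (hmul _ _ hz1 hw)) (hmul _ _ hw1 hw)))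
  obtain ⟨y, hy, hfix, -⟩ := hcon.exists_fixedPoint' hsc hmaps (x := x)
    (le_refl ‖x‖) (edist_ne_top _ _)
  refine ⟨y, lt_of_le_of_lt hy hr1, ?_⟩
  have h : x - a * y ^ 2 - b * y ^ 3 = y := hfix
  linear_combination -h

lemma norm_three_eq_one (h2 : ‖(2 : F)‖ < 1) : ‖(3 : F)‖ = 1 := by
  rw [show (3 : F) = 1 + 2 by norm_num]
  rw [IsUltrametricDist.norm_add_eq_max_of_norm_ne_norm] <;> rw [norm_one]
  · exact max_eq_left h2.le
  · exact h2.ne'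

lemma exists_one_add_cube_eq [CompleteSpace F] (h2 : ‖(2 : F)‖ < 1) {x : F} (hx : ‖x‖ < 1) :
    ∃ z : F, ‖z‖ < 1 ∧ (1 + z) ^ 3 = 1 + x := by
  have h3 := norm_three_eq_one h2
  have h30 : (3 : F) ≠ 0 := norm_ne_zero_iff.1 (by rw [h3]; exact one_ne_zero)
  obtain ⟨z, hz, h⟩ := exists_add_sq_add_cube_eq (a := 1) (b := 3⁻¹) (x := x / 3)
    norm_one.le (by simp [h3]) (by simpa [h3] using hx)
  refine ⟨z, hz, ?_⟩
  field_simp at h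
  linear_combination h

variable [CompleteSpace F] (V : NormDiscValuation F)

omit [IsUltrametricDist F] [CompleteSpace F] in
lemma one_add_ne_zero_of_norm_lt {y : F} (hy : ‖y‖ < 1) : 1 + y ≠ 0 := by
  intro h
  rw [eq_neg_of_add_eq_zero_right h] at hy
  simp at hy

/-- One-units are infinitely `3`-divisible, hence have order `0` for every discrete valuation. -/
lemma ord_one_add_eq_zero (h2 : ‖(2 : F)‖ < 1) {y : F} (hy : ‖y‖ < 1) : V.ord (1 + y) = 0 := by
  have key : ∀ k : ℕ, ∀ y : F, ‖y‖ < 1 → (3 : ℤ) ^ k ∣ V.ord (1 + y) := by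
    intro k
    induction k with
    | zero => simp
    | succ k ih =>
      intro y hy
      obtain ⟨z, hz, h⟩ := exists_one_add_cube_eq h2 hy
      rw [← h, V.ord_pow (one_add_ne_zero_of_norm_lt hz), pow_succ, mul_comm]
      exact mul_dvd_mul (by norm_num) (ih z hz)
  refine Int.eq_zero_of_abs_lt_dvd (key (V.ord (1 + y)).natAbs y hy) ?_
  rw [Int.abs_eq_natAbs]
  exact_mod_cast Nat.lt_pow_self (by norm_num : 1 < 3)

lemma ord_nonneg_of_norm_lt_one (h2 : ‖(2 : F)‖ < 1) {y : F} (hy : ‖y‖ < 1) : 0 ≤ V.ord y := by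
  by_cases h0 : y = 0
  · simp [h0, NormDiscValuation.ord, V.v_zero]
  by_contra! h
  exact (V.ord_one_add_neg h0 h).ne (ord_one_add_eq_zero V h2 hy)

omit [IsUltrametricDist F] [CompleteSpace F] in
lemma exists_pow_mul_norm_lt_one {x : F} (hx : ‖x‖ < 1) (y : F) :
    ∃ k : ℕ, ‖x ^ k * y‖ < 1 := by
  have h : Filter.Tendsto (fun k : ℕ => ‖x ^ k * y‖) Filter.atTop (nhds 0) := by
    simpa using ((tendsto_pow_atTop_nhds_zero_of_lt_one (norm_nonneg x) hx).mul_const ‖y‖)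
  exact (h.eventually_lt_const zero_lt_one).exists

lemma ord_two_pos [CharZero F] (h2 : ‖(2 : F)‖ < 1) : 0 < V.ord 2 := by
  obtain ⟨z, hz⟩ := V.v_surj (-1)
  have hz0 := V.ne_zero_of_v_eq hz
  obtain ⟨k, hk⟩ := exists_pow_mul_norm_lt_one h2 z
  have h := ord_nonneg_of_norm_lt_one V h2 hk
  rw [V.ord_mul (pow_ne_zero k two_ne_zero) hz0, V.ord_pow two_ne_zero, V.ord_eq hz] at h
  by_contra! h'
  nlinarith [(Nat.cast_nonneg k : (0 : ℤ) ≤ k)]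

lemma ord_pos_of_norm_lt_one [CharZero F] (h2 : ‖(2 : F)‖ < 1) {y : F} (h0 : y ≠ 0)
    (hy : ‖y‖ < 1) : 0 < V.ord y := by
  obtain ⟨k, hk⟩ := exists_pow_mul_norm_lt_one hy 2⁻¹
  have h := ord_nonneg_of_norm_lt_one V h2 hk
  rw [V.ord_mul (pow_ne_zero k h0) (inv_ne_zero two_ne_zero), V.ord_pow h0,
    V.ord_inv two_ne_zero] at h
  have := ord_two_pos V h2
  by_contra! h'
  nlinarith [(Nat.cast_nonneg k : (0 : ℤ) ≤ k)]

lemma norm_le_one_of_ord_nonneg [CharZero F] (h2 : ‖(2 : F)‖ < 1) {x : F}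
    (h : 0 ≤ V.ord x) : ‖x‖ ≤ 1 := by
  by_cases h0 : x = 0
  · simp [h0]
  by_contra! hx
  have := ord_pos_of_norm_lt_one V h2 (inv_ne_zero h0)
    (by rw [norm_inv]; exact inv_lt_one_of_one_lt₀ hx)
  rw [V.ord_inv h0] at this
  lia

lemma norm_eq_one_of_ord_eq_zero [CharZero F] (h2 : ‖(2 : F)‖ < 1) {x : F} (h0 : x ≠ 0)
    (h : V.ord x = 0) : ‖x‖ = 1 := by
  refine le_antisymm (norm_le_one_of_ord_nonneg V h2 h.ge) ?_
  have := norm_le_one_of_ord_nonneg V h2 (x := x⁻¹) (by rw [V.ord_inv h0, h, neg_zero])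
  rw [norm_inv] at this
  exact (inv_le_one₀ (norm_pos_iff.2 h0)).1 this

omit [CompleteSpace F] in
/-- The residue field of a locally compact field of residue characteristic `2` is perfect. -/
lemma exists_norm_sub_sq_lt_one [ProperSpace F] (h2 : ‖(2 : F)‖ < 1) {x : F} (hx : ‖x‖ = 1) :
    ∃ s : F, ‖s‖ = 1 ∧ ‖x - s ^ 2‖ < 1 := by
  have hpow : ∀ k : ℕ, ‖x ^ k‖ = 1 := fun k => by rw [norm_pow, hx, one_pow]
  have hex : ∃ d : ℕ, 0 < d ∧ ‖x ^ d - 1‖ < 1 := by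
    obtain ⟨l, -, φ, hφ, hl⟩ := (isCompact_closedBall (0 : F) 1).tendsto_subseq
      (x := fun k : ℕ => x ^ k) (fun k => by simp [hx])
    obtain ⟨N, hN⟩ := Metric.cauchySeq_iff.1 hl.cauchySeq 1 one_pos
    have h := hN (N + 1) (by simp) N le_rfl
    have hlt : φ N < φ (N + 1) := hφ (Nat.lt_succ_self N)
    refine ⟨φ (N + 1) - φ N, Nat.sub_pos_of_lt hlt, ?_⟩
    rw [dist_eq_norm] at h
    have : x ^ φ (N + 1) - x ^ φ N = x ^ φ N * (x ^ (φ (N + 1) - φ N) - 1) := by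
      rw [mul_sub, ← pow_add, Nat.add_sub_cancel' hlt.le, mul_one]
    simpa [Function.comp_def, this, norm_mul, hpow] using h
  obtain ⟨hd, hlt⟩ := Nat.find_spec hex
  have hmin := fun m => Nat.find_min (m := m) hex
  set d := Nat.find hex
  rcases Nat.even_or_odd' d with ⟨c, hc | hc⟩
  · exfalso
    refine hmin c (by lia) ⟨by lia, ?_⟩
    have h2c : ‖2 * (x ^ c - 1)‖ < 1 := by
      rw [norm_mul]
      have := norm_sub_le_max' (x ^ c) 1
      rw [hpow, norm_one, max_self] at this
      nlinarith [norm_nonneg (x ^ c - 1), norm_nonneg (2 : F)]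
    have h := norm_sub_lt_one hlt h2c
    rw [show x ^ d - 1 - 2 * (x ^ c - 1) = (x ^ c - 1) ^ 2 by rw [hc]; ring, norm_pow] at h
    exact (sq_lt_one_iff₀ (norm_nonneg _)).1 h
  · refine ⟨x ^ (c + 1), hpow _, ?_⟩
    rw [show x - (x ^ (c + 1)) ^ 2 = -(x * (x ^ d - 1)) by rw [hc]; ring, norm_neg, norm_mul, hx,
      one_mul]
    exact hlt

/-- Units are norms from the unramified quadratic extension generated by a square root of
`x₀ ^ 2 + 4 * ρ`. -/
lemma exists_eq_sq_sub_mul_sq [ProperSpace F] [CharZero F] (h2 : ‖(2 : F)‖ < 1) {x₀ ρ ε : F}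
    (hx₀ : ‖x₀‖ = 1) (hρ : ‖ρ‖ ≤ 1) (hε : ‖ε‖ = 1) :
    ∃ a b : F, x₀ ^ 2 + 4 * ρ = a ^ 2 - ε * b ^ 2 := by
  obtain ⟨s, hs, hlt⟩ := exists_norm_sub_sq_lt_one h2 hε
  have hs0 : s ≠ 0 := norm_ne_zero_iff.1 (by rw [hs]; exact one_ne_zero)
  have hx0 : x₀ ≠ 0 := norm_ne_zero_iff.1 (by rw [hx₀]; exact one_ne_zero)
  obtain ⟨b, -, hb⟩ := exists_add_sq_add_cube_eq (a := -ρ / (x₀ * s)) (b := 0)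
    (x := (ε - s ^ 2) / (x₀ * s)) (by simpa [hs, hx₀] using hρ) (by simp)
    (by simpa [hs, hx₀] using hlt)
  have hb' : s ^ 2 + x₀ * s * b - ρ * b ^ 2 = ε := by
    field_simp at hb
    linear_combination hb
  by_cases hb0 : b = 0
  · have hε' : ε = s ^ 2 := by rw [← hb', hb0]; ring
    refine ⟨(x₀ ^ 2 + 4 * ρ + 1) / 2, (x₀ ^ 2 + 4 * ρ - 1) / (2 * s), ?_⟩
    rw [hε']
    field_simp
    ring
  · refine ⟨(2 * s + x₀ * b) / b, 2 / b, ?_⟩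
    field_simp
    linear_combination -4 * hb'

lemma exists_eq_sq_sub_unit_mul_sq_of_proper [ProperSpace F] [CharZero F] (h2 : ‖(2 : F)‖ < 1)
    {Δ x₀ ε : F} (hΔ0 : Δ ≠ 0) (hΔ : V.ord Δ = 0)
    (hx₀ : Δ = x₀ ^ 2 ∨ 2 * V.ord 2 ≤ V.ord (Δ - x₀ ^ 2)) (hε0 : ε ≠ 0) (hε : V.ord ε = 0) :
    ∃ a b : F, Δ = a ^ 2 - ε * b ^ 2 := by
  rcases hx₀ with rfl | hx₀
  · exact ⟨x₀, 0, by ring⟩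
  by_cases hz : Δ - x₀ ^ 2 = 0
  · exact ⟨x₀, 0, by linear_combination hz⟩
  set ρ := (Δ - x₀ ^ 2) / 4 with hρ
  have h40 : (4 : F) ≠ 0 := by norm_num
  have h4 : V.ord 4 = 2 * V.ord 2 := by
    rw [show (4 : F) = 2 ^ 2 by norm_num, V.ord_pow two_ne_zero, Nat.cast_two]
  have hΔρ : Δ = x₀ ^ 2 + 4 * ρ := by rw [hρ]; field_simp; ring
  have hρ1 : ‖ρ‖ ≤ 1 := by
    refine norm_le_one_of_ord_nonneg V h2 ?_
    rw [hρ, div_eq_mul_inv, V.ord_mul hz (inv_ne_zero h40), V.ord_inv h40, h4]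
    linarith
  have h4ρ : ‖4 * ρ‖ < 1 := by
    rw [show 4 * ρ = 2 * (2 * ρ) by ring, norm_mul, norm_mul]
    nlinarith [norm_nonneg (2 : F), norm_nonneg ρ, mul_nonneg (norm_nonneg (2 : F)) (norm_nonneg ρ)]
  have hΔ1 := norm_eq_one_of_ord_eq_zero V h2 hΔ0 hΔ
  have hx1 : ‖x₀‖ = 1 := by
    have h : ‖Δ - 4 * ρ‖ = 1 := by
      rw [sub_eq_add_neg, IsUltrametricDist.norm_add_eq_max_of_norm_ne_norm] <;>
        rw [norm_neg, hΔ1]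
      · exact max_eq_left h4ρ.le
      · exact h4ρ.ne'
    rw [show Δ - 4 * ρ = x₀ ^ 2 by linear_combination hΔρ, norm_pow] at h
    exact (pow_eq_one_iff_of_nonneg (norm_nonneg x₀) two_ne_zero).1 h
  rw [hΔρ]
  exact exists_eq_sq_sub_mul_sq h2 hx1 hρ1 (norm_eq_one_of_ord_eq_zero V h2 hε0 hε)

end Normed

/-- `(Δ, ε)_𝔭 = 1` for units `Δ`, `ε` with `Δ` of quadratic defect `4𝒪_F`. -/
lemma exists_eq_sq_sub_unit_mul_sq [Field F] [Algebra ℚ_[2] F] [FiniteDimensional ℚ_[2] F]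
    (V : NormDiscValuation F) {e : ℤ} (he : V.v 2 = (e : WithTop ℤ)) {Δ : F}
    (hΔu : V.v Δ = (0 : WithTop ℤ)) (hΔd : relDefect V Δ = ((2 * e : ℤ) : WithTop ℤ))
    {ε : F} (hε : V.v ε = (0 : WithTop ℤ)) : ∃ a b : F, Δ = a ^ 2 - ε * b ^ 2 := by
  have hΔu' : V.v Δ = ((0 : ℤ) : WithTop ℤ) := hΔu
  have hε' : V.v ε = ((0 : ℤ) : WithTop ℤ) := hε
  have hΔ0 := V.ne_zero_of_v_eq hΔu'
  have hx : ∃ x₀ : F, Δ = x₀ ^ 2 ∨ 2 * V.ord 2 ≤ V.ord (Δ - x₀ ^ 2) := by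
    by_contra! h
    have hle : relDefect V Δ ≤ ((2 * e - 1 : ℤ) : WithTop ℤ) := by
      refine (WithTop.isLUB_sSup' (Set.range_nonempty _)).2 ?_
      rintro _ ⟨x, rfl⟩
      obtain ⟨hx, hlt⟩ := h x
      have hx0 : Δ - x ^ 2 ≠ 0 := sub_ne_zero.2 hx
      beta_reduce
      rw [← V.coe_ord (div_ne_zero hx0 hΔ0), WithTop.coe_le_coe, div_eq_mul_inv,
        V.ord_mul hx0 (inv_ne_zero hΔ0), V.ord_inv hΔ0, V.ord_eq hΔu']
      rw [V.ord_eq he] at hlt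
      lia
    rw [hΔd, WithTop.coe_le_coe] at hle
    lia
  obtain ⟨x₀, hx₀⟩ := hx
  let : NormedField F := spectralNorm.normedField ℚ_[2] F
  let : NormedSpace ℚ_[2] F := spectralNorm.normedSpace ℚ_[2] F
  have : IsUltrametricDist F :=
    IsUltrametricDist.isUltrametricDist_of_forall_norm_add_le_max_norm
      isNonarchimedean_spectralNorm
  have : ProperSpace F := FiniteDimensional.proper ℚ_[2] F
  have : CharZero F := charZero_of_injective_algebraMap (algebraMap ℚ_[2] F).injective
  have h2 : ‖(2 : F)‖ < 1 := by
    have h : ‖algebraMap ℚ_[2] F 2‖ = ‖(2 : ℚ_[2])‖ := spectralNorm_extends 2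
    rw [map_ofNat] at h
    rw [h]
    exact_mod_cast Padic.norm_p_lt_one (p := 2)
  exact exists_eq_sq_sub_unit_mul_sq_of_proper V h2 hΔ0 (V.ord_eq hΔu') hx₀
    (V.ne_zero_of_v_eq hε') (V.ord_eq hε')

section QuadraticSpaces

open QuadraticMap Matrix

variable [Field F]

lemma diagQF_apply {n : ℕ} (w x : Fin n → F) : diagQF n w x = ∑ i, w i * (x i * x i) := by
  simp [diagQF, weightedSumSquares_apply]

lemma polar_diagQF {n : ℕ} (w x y : Fin n → F) :
    polar (diagQF n w) x y = 2 * ∑ i, w i * (x i * y i) := by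
  simp only [polar, diagQF_apply, Pi.add_apply, ← Finset.sum_sub_distrib, Finset.mul_sum]
  exact Finset.sum_congr rfl fun i _ => by ring

lemma polar_diagQF_single {n : ℕ} (w x : Fin n → F) (i : Fin n) :
    polar (diagQF n w) x (Pi.single i 1) = 2 * (w i * x i) := by
  simp [polar_diagQF, Pi.single_apply]

lemma polar_isometry_map {M N : Type*} [AddCommGroup M] [AddCommGroup N] [Module F M] [Module F N]
    {Q : QuadraticForm F M} {Q' : QuadraticForm F N} (f : Q →qᵢ Q') (x y : M) :
    polar Q' (f x) (f y) = polar Q x y := by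
  simp only [polar, ← map_add, f.map_app]

/-- Isometries out of a nondegenerate diagonal space are injective. -/
lemma isometry_diagQF_injective [CharZero F] {n : ℕ} {w : Fin n → F} (hw : ∀ i, w i ≠ 0)
    {M : Type*} [AddCommGroup M] [Module F M] {Q : QuadraticForm F M} (f : diagQF n w →qᵢ Q) :
    Function.Injective f := by
  refine (injective_iff_map_eq_zero f).2 fun x hx => funext fun i => ?_
  have h := polar_isometry_map f x (Pi.single i 1)
  rw [hx, polar_diagQF_single, polar_zero_left] at h
  simpa [hw i] using h.symm

/-- A codimension one nondegenerate diagonal subspace of a diagonal space has an orthogonal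
complement spanned by a vector whose value is determined up to squares by the determinants. -/
lemma exists_orthogonal_vector [CharZero F] {n : ℕ} {w : Fin n → F} {d : Fin (n + 1) → F}
    (hw : ∀ i, w i ≠ 0) (f : diagQF n w →qᵢ diagQF (n + 1) d) :
    ∃ (u : Fin (n + 1) → F) (t : F), t ≠ 0 ∧ (∀ x, polar (diagQF (n + 1) d) (f x) u = 0) ∧
      diagQF (n + 1) d u * ∏ i, w i = (∏ i, d i) * t ^ 2 := by
  let B : (Fin (n + 1) → F) →ₗ[F] (Fin n → F) :=
    LinearMap.pi fun i => (diagQF (n + 1) d).polarBilin (f (Pi.single i 1))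
  obtain ⟨u, hu, hu0⟩ := B.ker.exists_mem_ne_zero_of_ne_bot
    (LinearMap.ker_ne_bot_of_finrank_lt (by simp))
  have hfu : ∀ x, polar (diagQF (n + 1) d) (f x) u = 0 := by
    have h : ((diagQF (n + 1) d).polarBilin.flip u) ∘ₗ f.toLinearMap = 0 :=
      LinearMap.pi_ext' fun i => LinearMap.ext_ring (congrFun hu i)
    exact fun x => LinearMap.congr_fun h x
  let c : Fin (n + 1) → Fin (n + 1) → F :=
    Fin.snoc (α := fun _ => Fin (n + 1) → F) (fun j => f (Pi.single j 1)) u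
  let M : Matrix (Fin (n + 1)) (Fin (n + 1)) F := Matrix.of fun i j => c j i
  let D : Fin (n + 1) → F := Fin.snoc (α := fun _ => F) w (diagQF (n + 1) d u)
  have hM : Mᵀ * diagonal d * M = diagonal D := by
    ext j k
    have hjk : (Mᵀ * diagonal d * M) j k = polar (diagQF (n + 1) d) (c j) (c k) / 2 := by
      rw [polar_diagQF, mul_div_cancel_left₀ _ two_ne_zero, Matrix.mul_apply]
      refine Finset.sum_congr rfl fun i _ => ?_
      rw [Matrix.mul_diagonal]
      simp only [M, Matrix.transpose_apply, Matrix.of_apply]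
      ring
    rw [hjk]
    refine Fin.lastCases ?_ (fun j => ?_) j <;> refine Fin.lastCases ?_ (fun k => ?_) k
    · simp [c, D, polar_self]
    · simp [c, polar_comm _ u, hfu, (Fin.castSucc_lt_last k).ne']
    · simp [c, hfu, (Fin.castSucc_lt_last j).ne]
    · simp only [c, D, Fin.snoc_castSucc, polar_isometry_map, polar_diagQF_single,
        Matrix.diagonal_apply, Fin.castSucc_inj, Pi.single_apply, eq_comm (a := k)]
      split_ifs with h
      · simp [h]
      · simp
  have hdet : M.det ≠ 0 := by
    intro h0
    obtain ⟨a, ha0, ha⟩ := Matrix.exists_mulVec_eq_zero_iff.2 h0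
    have hDa : diagonal D *ᵥ a = 0 := by
      rw [← hM, ← Matrix.mulVec_mulVec, ha, Matrix.mulVec_zero]
    have hinit : ∀ j : Fin n, a j.castSucc = 0 := fun j => by
      have h := congrFun hDa j.castSucc
      simpa [Matrix.mulVec_diagonal, D, hw j] using h
    obtain ⟨i, hi⟩ := Function.ne_iff.1 hu0
    have hlast : a (Fin.last n) = 0 := by
      have h := congrFun ha i
      simp only [Matrix.mulVec, dotProduct, Fin.sum_univ_castSucc, hinit, mul_zero,
        Finset.sum_const_zero, zero_add, M, Matrix.of_apply, c, Fin.snoc_last,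
        Pi.zero_apply] at h
      exact (mul_eq_zero.1 h).resolve_left hi
    exact ha0 (funext fun j => Fin.lastCases hlast hinit j)
  refine ⟨u, M.det, hdet, hfu, ?_⟩
  have h := congrArg Matrix.det hM
  simp only [Matrix.det_mul, Matrix.det_transpose, Matrix.det_diagonal, D] at h
  rw [Fin.prod_snoc] at h
  linear_combination -h

/-- Reflections act transitively on vectors of a given nonzero value. -/
lemma exists_isometry_map_eq_s12 [CharZero F] {M : Type*} [AddCommGroup M] [Module F M]
    (Q : QuadraticForm F M) {u v : M} (huv : Q u = Q v) (hu : Q u ≠ 0) :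
    ∃ τ : Q →qᵢ Q, τ u = v ∨ τ u = -v := by
  have key : ∀ v : M, Q u = Q v → Q (u - v) ≠ 0 → ∃ τ : Q →qᵢ Q, τ u = v := by
    intro v huv hne
    set a := u - v with ha
    have hpol : polar Q u a = Q a := by
      have h2 : polar Q v a = Q u - Q v - Q a := by simp [polar, ha]
      have h3 : polar Q u a = polar Q a a + polar Q v a := by
        rw [← polar_add_left, ha, sub_add_cancel]
      rw [h3, h2, polar_self, huv, two_smul]
      ring
    refine ⟨⟨LinearMap.id - ((Q a)⁻¹ • Q.polarBilin a).smulRight a, fun x => ?_⟩, ?_⟩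
    · change Q (x - ((Q a)⁻¹ • polar Q a x) • a) = Q x
      have h : ∀ r : F, Q (x - r • a) = Q x + r * r * Q a - r * polar Q a x := by
        intro r
        have h := polar_smul_right Q (-r) x a
        rw [polar_comm Q x a, neg_smul, polar, ← sub_eq_add_neg, QuadraticMap.map_neg,
          QuadraticMap.map_smul, smul_eq_mul, smul_eq_mul] at h
        linear_combination h
      rw [h, smul_eq_mul]
      field_simp
      ring
    · change u - ((Q a)⁻¹ • polar Q a u) • a = v
      rw [polar_comm, hpol, smul_eq_mul, inv_mul_cancel₀ hne, one_smul, ha, sub_sub_cancel]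
  by_cases h : Q (u - v) = 0
  · obtain ⟨τ, hτ⟩ := key (-v) (by rw [QuadraticMap.map_neg, huv]) (by
      have h1 : Q (u + v) + Q (u - v) = 2 * Q u + 2 * Q v := by
        have h2 : polar Q u (-v) = -polar Q u v := polar_neg_right Q u v
        simp only [polar, ← sub_eq_add_neg, QuadraticMap.map_neg] at h2
        linear_combination h2
      rw [sub_neg_eq_add]
      intro h0
      rw [h, h0, ← huv] at h1
      refine hu ?_
      linear_combination -h1 / 4)
    exact ⟨τ, Or.inr hτ⟩
  · obtain ⟨τ, hτ⟩ := key v huv h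
    exact ⟨τ, Or.inl hτ⟩

lemma range_eq_ker_polarBilin [CharZero F] {n : ℕ} {M : Type*} [AddCommGroup M] [Module F M]
    [FiniteDimensional F M] (hM : Module.finrank F M = n + 1) {Q : QuadraticForm F M}
    {w : Fin n → F} (hw : ∀ i, w i ≠ 0) (f : diagQF n w →qᵢ Q) {u : M} (hu : Q u ≠ 0)
    (hf : ∀ x, polar Q (f x) u = 0) :
    LinearMap.range f.toLinearMap = LinearMap.ker (Q.polarBilin u) := by
  refine Submodule.eq_of_le_of_finrank_eq ?_ ?_
  · rintro _ ⟨x, rfl⟩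
    exact (polar_comm Q _ _).trans (hf x)
  · rw [LinearMap.finrank_range_of_inj (isometry_diagQF_injective hw f), Module.finrank_fin_fun]
    have hne : Q.polarBilin u ≠ 0 := by
      intro h0
      have h1 : polar Q u u = 0 := LinearMap.congr_fun h0 u
      rw [polar_self] at h1
      simp [hu] at h1
    have := Module.Dual.finrank_ker_add_one_of_ne_zero hne
    lia

/-- Two nondegenerate hyperplanes of a quadratic space with equal determinants are isometric. -/
lemma equivalent_of_isometry_of_prod_eq [CharZero F] {n : ℕ} {w w' : Fin n → F}
    {d : Fin (n + 1) → F} (hw : ∀ i, w i ≠ 0) (hw' : ∀ i, w' i ≠ 0) (hd : ∀ i, d i ≠ 0)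
    (f : diagQF n w →qᵢ diagQF (n + 1) d) (g : diagQF n w' →qᵢ diagQF (n + 1) d) {s : F}
    (hs : s ≠ 0) (hprod : ∏ i, w i = (∏ i, w' i) * s ^ 2) :
    QuadraticMap.Equivalent (diagQF n w) (diagQF n w') := by
  obtain ⟨u, t, ht, hfu, hu⟩ := exists_orthogonal_vector hw f
  obtain ⟨u', t', ht', hgu', hu'⟩ := exists_orthogonal_vector hw' g
  have hP : ∏ i, d i ≠ 0 := Finset.prod_ne_zero_iff.2 fun i _ => hd i
  have hP' : ∏ i, w' i ≠ 0 := Finset.prod_ne_zero_iff.2 fun i _ => hw' i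
  have hu0 : (diagQF (n + 1) d) u ≠ 0 := by
    intro h
    rw [h, zero_mul] at hu
    exact mul_ne_zero hP (pow_ne_zero 2 ht) hu.symm
  set v := (t / (t' * s)) • u' with hv
  have huv : (diagQF (n + 1) d) u = (diagQF (n + 1) d) v := by
    rw [hv, QuadraticMap.map_smul, smul_eq_mul]
    field_simp
    refine mul_right_cancel₀ hP' ?_
    rw [hprod] at hu
    linear_combination t' ^ 2 * hu - t ^ 2 * hu'
  have hgv : ∀ x, polar (diagQF (n + 1) d) (g x) v = 0 := fun x => by
    rw [hv, polar_smul_right, hgu', smul_zero]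
  obtain ⟨τ, hτ⟩ := exists_isometry_map_eq_s12 (diagQF (n + 1) d) huv hu0
  have hfv : ∀ x, polar (diagQF (n + 1) d) (τ.comp f x) v = 0 := by
    intro x
    have h := polar_isometry_map τ (f x) u
    rw [hfu] at h
    rcases hτ with hτ | hτ <;> rw [hτ] at h
    · exact h
    · rwa [polar_neg_right, neg_eq_zero] at h
  have hrange : LinearMap.range (τ.comp f).toLinearMap = LinearMap.range g.toLinearMap := by
    rw [range_eq_ker_polarBilin (by simp) hw _ (huv ▸ hu0) hfv,
      range_eq_ker_polarBilin (by simp) hw' _ (huv ▸ hu0) hgv]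
  let ef := LinearEquiv.ofInjective (τ.comp f).toLinearMap (isometry_diagQF_injective hw _)
  let eg := LinearEquiv.ofInjective g.toLinearMap (isometry_diagQF_injective hw' g)
  refine ⟨⟨ef.trans ((LinearEquiv.ofEq _ _ hrange).trans eg.symm), fun x => ?_⟩⟩
  set y := (ef.trans ((LinearEquiv.ofEq _ _ hrange).trans eg.symm)) x with hy
  have h : g y = τ.comp f x := by
    have h1 : eg y = LinearEquiv.ofEq _ _ hrange (ef x) := by
      rw [hy]
      exact eg.apply_symm_apply _
    exact congrArg Subtype.val h1
  change diagQF n w' y = diagQF n w x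
  rw [← g.map_app, h, Isometry.map_app]

end QuadraticSpaces

section Hyperbolic

variable [Field F]

/-- If the last weight of `w` is represented by the last two weights of `d`, and all other weights
agree, then the space with weights `d` represents the space with weights `w`. -/
lemma exists_isometry_of_last {k : ℕ} {w : Fin (k + 1) → F} {d : Fin (k + 2) → F} {a b : F}
    (h : ∀ i : Fin k, w i.castSucc = d i.castSucc.castSucc)
    (hlast : w (Fin.last k) =
      d (Fin.last k).castSucc * a ^ 2 + d (Fin.last (k + 1)) * b ^ 2) :
    Nonempty (diagQF (k + 1) w →qᵢ diagQF (k + 2) d) := by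
  let f : (Fin (k + 1) → F) →ₗ[F] (Fin (k + 2) → F) := LinearMap.pi
    (Fin.snoc (α := fun _ => (Fin (k + 1) → F) →ₗ[F] F)
      (Fin.snoc (α := fun _ => (Fin (k + 1) → F) →ₗ[F] F)
        (fun i => LinearMap.proj i.castSucc) (a • LinearMap.proj (Fin.last k)))
      (b • LinearMap.proj (Fin.last k)))
  refine ⟨⟨f, fun x => ?_⟩⟩
  change diagQF (k + 2) d (f x) = _
  simp only [diagQF_apply, Fin.sum_univ_castSucc, h, hlast, f, LinearMap.pi_apply,
    Fin.snoc_castSucc, Fin.snoc_last, LinearMap.proj_apply, LinearMap.smul_apply, smul_eq_mul]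
  ring

lemma padDiag_ne_zero {n : ℕ} {l : List F} (hl : ∀ x ∈ l, x ≠ 0) (hn : l.length ≤ n)
    (i : Fin n) : padDiag n l i ≠ 0 := by
  unfold padDiag
  split_ifs with h1 h2
  · exact one_ne_zero
  · exact neg_ne_zero.2 one_ne_zero
  · have hlt : (i : ℕ) - (n - l.length) < l.length := by
      have := i.2
      lia
    rw [List.getD_eq_getElem _ _ hlt]
    exact hl _ (List.getElem_mem hlt)

lemma prod_padDiag_pair (m : ℕ) (x y : F) :
    ∏ i, padDiag (2 * m + 2) [x, y] i = (-1) ^ m * x * y := by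
  have hrange : ∏ i ∈ Finset.range (2 * m), (if i % 2 = 0 then (1 : F) else -1) = (-1) ^ m := by
    induction m with
    | zero => simp
    | succ m ih =>
      rw [show 2 * (m + 1) = 2 * m + 1 + 1 by ring, Finset.prod_range_succ,
        Finset.prod_range_succ, ih, if_pos (by lia), if_neg (by lia), pow_succ, mul_one]
  rw [Fin.prod_univ_castSucc, Fin.prod_univ_castSucc, ← hrange,
    ← Fin.prod_univ_eq_prod_range (fun i => if i % 2 = 0 then (1 : F) else -1)]
  simp [padDiag]

end Hyperbolic

/-- for even `n ≥ 2`, `μ ∈ {1, Δ}` and a unit `ε`, the space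
`W₁^{n+1}(ε) = ℍ^{n/2} ⊥ [ε]` represents `W₁ⁿ(μ) = ℍ^{(n-2)/2} ⊥ [1,-μ]` but does not
represent `W₂ⁿ(μ)` (any `n`-dimensional space of determinant `(-1)^{n/2}μ` not isometric
to `W₁ⁿ(μ)`), when the latter is defined. -/
theorem W1_succ_represents_W1_not_W2 [Field F] [Algebra ℚ_[2] F]
    [FiniteDimensional ℚ_[2] F] (V : NormDiscValuation F) (e : ℤ)
    (he : V.v 2 = (e : WithTop ℤ)) (Δ : F) (hΔu : V.v Δ = (0 : WithTop ℤ))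
    (hΔd : relDefect V Δ = ((2 * e : ℤ) : WithTop ℤ))
    (n : ℕ) (hn2 : 2 ≤ n) (hne : Even n) (μ : F) (hμ : μ = 1 ∨ μ = Δ)
    (ε : F) (hε : V.v ε = (0 : WithTop ℤ)) :
    QRep (diagQF (n + 1) (padDiag (n + 1) [ε])) (diagQF n (padDiag n [1, -μ])) ∧
      ∀ w : Fin n → F, (∀ i, w i ≠ 0) →
        (∃ t : F, t ≠ 0 ∧ (∏ i, w i) = (-1 : F) ^ (n / 2) * μ * t ^ 2) →
        ¬ QuadraticMap.Equivalent (diagQF n w) (diagQF n (padDiag n [1, -μ])) →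
        ¬ QRep (diagQF (n + 1) (padDiag (n + 1) [ε])) (diagQF n w) := by
  have : CharZero F := charZero_of_injective_algebraMap (algebraMap ℚ_[2] F).injective
  obtain ⟨m, rfl⟩ : ∃ m, n = 2 * m + 2 := by
    obtain ⟨r, rfl⟩ := hne
    exact ⟨r - 1, by lia⟩
  have hε0 : ε ≠ 0 := V.ne_zero_of_v_eq (k := 0) hε
  have hμ0 : μ ≠ 0 := by
    rcases hμ with rfl | rfl
    · exact one_ne_zero
    · exact V.ne_zero_of_v_eq (k := 0) hΔu
  obtain ⟨a, b, hab⟩ : ∃ a b : F, μ = a ^ 2 - ε * b ^ 2 := by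
    rcases hμ with rfl | rfl
    · exact ⟨1, 0, by ring⟩
    · exact exists_eq_sq_sub_unit_mul_sq V he hΔu hΔd hε
  have hw₁ : ∀ i, padDiag (2 * m + 2) [1, -μ] i ≠ 0 :=
    padDiag_ne_zero (by simp [hμ0]) (by simp)
  have hd : ∀ i, padDiag (2 * m + 2 + 1) [ε] i ≠ 0 :=
    padDiag_ne_zero (by simp [hε0]) (by simp)
  obtain ⟨f⟩ : Nonempty (diagQF (2 * m + 2) (padDiag (2 * m + 2) [1, -μ]) →qᵢ
      diagQF (2 * m + 2 + 1) (padDiag (2 * m + 2 + 1) [ε])) := by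
    refine exists_isometry_of_last (a := a) (b := b) (fun i => ?_) ?_
    · refine Fin.lastCases ?_ (fun i => ?_) i
      · simp [padDiag]
      · simp [padDiag, i.2.trans (show 2 * m < 2 * m + 2 by lia)]
    · simp [padDiag]
      linear_combination -hab
  refine ⟨⟨f, isometry_diagQF_injective hw₁ f⟩, ?_⟩
  rintro w hw ⟨t, ht, hprod⟩ hne' ⟨g, -⟩
  refine hne' (equivalent_of_isometry_of_prod_eq hw hw₁ hd g f ht ?_)
  rw [hprod, prod_padDiag_pair, show (2 * m + 2) / 2 = m + 1 by lia]
  ring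
end
end

section
/- Let F be a dyadic local field with e = ord(2) and Δ a unit with quadratic defect 4𝒪_F. Let M ≅ ≺a₁,…,a_m≻ be an integral 𝒪_F-lattice relative to a good BONG with R_i = ord(a_i). If R_j = -2e for some even index j, then the quadratic space [a₁,…,a_j] is isometric to ℍ^{j/2} or ℍ^{(j-2)/2} ⊥ [1,-Δ]. -/
noncomputable section
open scoped Classical

variable {F : Type*}

namespace NormDiscValuation

variable [Field F] (V : NormDiscValuation F)

theorem v_one : V.v 1 = 0 := by
  have h := V.v_mul 1 1
  have h1 := V.v_ne_top 1 one_ne_zero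
  lift V.v 1 to ℤ using h1 with n hn
  rw [mul_one, ← hn] at h
  norm_cast at h ⊢
  omega

/-- The valuation as a Mathlib additive valuation. -/
def toAddValuation : AddValuation F (WithTop ℤ) :=
  AddValuation.of V.v V.v_zero V.v_one V.v_add V.v_mul

theorem v_neg (x : F) : V.v (-x) = V.v x := V.toAddValuation.map_neg x

theorem v_pow (x : F) (n : ℕ) : V.v (x ^ n) = n • V.v x := V.toAddValuation.map_pow x n

theorem v_inv (x : F) : V.v x⁻¹ = -V.v x := V.toAddValuation.map_inv

theorem v_eq_top_iff {x : F} : V.v x = ⊤ ↔ x = 0 := V.toAddValuation.top_iff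

theorem le_v_add {x y : F} {g : WithTop ℤ} (hx : g ≤ V.v x) (hy : g ≤ V.v y) :
    g ≤ V.v (x + y) := V.toAddValuation.map_le_add hx hy

theorem lt_v_add {x y : F} {g : WithTop ℤ} (hx : g < V.v x) (hy : g < V.v y) :
    g < V.v (x + y) := V.toAddValuation.map_lt_add hx hy

theorem v_add_eq_left {x y : F} (h : V.v x < V.v y) : V.v (x + y) = V.v x :=
  V.toAddValuation.map_add_eq_of_lt_left h

theorem v_mul_nonneg {x y : F} (hx : 0 ≤ V.v x) (hy : 0 ≤ V.v y) : 0 ≤ V.v (x * y) := by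
  rw [v_mul]
  exact add_nonneg hx hy

theorem v_mul_pos {x y : F} (hx : 0 < V.v x) (hy : 0 ≤ V.v y) : 0 < V.v (x * y) := by
  rw [v_mul]
  exact add_pos_of_pos_of_nonneg hx hy

theorem v_natCast_nonneg (n : ℕ) : 0 ≤ V.v n := by
  induction n with
  | zero => simp [V.v_zero]
  | succ n ih =>
    rw [Nat.cast_succ]
    exact V.le_v_add ih V.v_one.ge

/-- The valuation ring. -/
def integers : ValuationSubring F where
  carrier := {x | 0 ≤ V.v x}
  mul_mem' := V.v_mul_nonneg
  one_mem' := V.v_one.ge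
  add_mem' := V.le_v_add
  zero_mem' := by simp [V.v_zero]
  neg_mem' {x} hx := by
    change 0 ≤ V.v (-x)
    rwa [v_neg]
  mem_or_inv_mem' x := by
    change 0 ≤ V.v x ∨ 0 ≤ V.v x⁻¹
    by_cases hx : x = 0
    · simp [hx, V.v_zero]
    have h1 := V.v_ne_top x hx
    rw [v_inv]
    lift V.v x to ℤ using h1 with n
    rw [← WithTop.LinearOrderedAddCommGroup.coe_neg]
    norm_cast
    omega

theorem mem_integers {x : F} : x ∈ V.integers ↔ 0 ≤ V.v x := Iff.rfl

theorem mem_maximalIdeal_integers {x : V.integers} :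
    x ∈ IsLocalRing.maximalIdeal V.integers ↔ 0 < V.v x := by
  rw [IsLocalRing.mem_maximalIdeal, mem_nonunits_iff, lt_iff_le_and_ne,
    and_iff_right (V.mem_integers.1 x.2), not_iff_not]
  constructor
  · rintro ⟨u, rfl⟩
    have h : V.v (u : V.integers) + V.v (↑u⁻¹ : V.integers) = 0 := by
      rw [← v_mul, ← V.v_one]
      exact congrArg (fun z : V.integers => V.v z) u.mul_inv
    have hu := V.mem_integers.1 (u : V.integers).2
    have hu' := V.mem_integers.1 (↑u⁻¹ : V.integers).2
    exact ((add_eq_zero_iff_of_nonneg hu hu').1 h).1.symm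
  · intro h
    have hx : (x : F) ≠ 0 := fun h0 => by simp [h0, V.v_zero] at h
    refine IsUnit.of_mul_eq_one ⟨(x : F)⁻¹, ?_⟩ (Subtype.ext (mul_inv_cancel₀ hx))
    rw [mem_integers, v_inv, ← h, neg_zero]

theorem residueField_two_eq_zero (h2 : 0 < V.v 2) :
    (2 : IsLocalRing.ResidueField V.integers) = 0 := by
  rw [← map_ofNat (IsLocalRing.residue V.integers) 2, IsLocalRing.residue_eq_zero_iff,
    mem_maximalIdeal_integers]
  exact h2

/-- Over a finite residue field of characteristic two, every integer is a square
modulo the maximal ideal. -/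
theorem exists_sub_sq_pos [Finite (IsLocalRing.ResidueField V.integers)] (h2 : 0 < V.v 2)
    {u : F} (hu : 0 ≤ V.v u) : ∃ t, 0 ≤ V.v t ∧ 0 < V.v (u - t ^ 2) := by
  have := Fintype.ofFinite (IsLocalRing.ResidueField V.integers)
  have : CharP (IsLocalRing.ResidueField V.integers) 2 := 
    CharTwo.of_one_ne_zero_of_two_eq_zero one_ne_zero (V.residueField_two_eq_zero h2)
  obtain ⟨t, ht⟩ := FiniteField.isSquare_of_char_two (ringChar.eq _ 2)
    (IsLocalRing.residue V.integers ⟨u, hu⟩)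
  obtain ⟨t, rfl⟩ := IsLocalRing.residue_surjective t
  refine ⟨t, t.2, ?_⟩
  rw [← map_mul, ← sub_eq_zero, ← map_sub, IsLocalRing.residue_eq_zero_iff,
    mem_maximalIdeal_integers] at ht
  rw [pow_two]
  exact ht

/-- The Artin--Schreier map `y ↦ y ^ 2 + y` has cokernel of order at most two on a finite residue
field of characteristic two. -/
theorem exists_sub_artinSchreier_pos [Finite (IsLocalRing.ResidueField V.integers)]
    (h2 : 0 < V.v 2) {σ ρ : F} (hσ : 0 ≤ V.v σ) (hρ : 0 ≤ V.v ρ) :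
    (∃ y, 0 ≤ V.v y ∧ 0 < V.v (σ - (y ^ 2 + y))) ∨
    (∃ y, 0 ≤ V.v y ∧ 0 < V.v (ρ - (y ^ 2 + y))) ∨
    ∃ y, 0 ≤ V.v y ∧ 0 < V.v (σ + ρ - (y ^ 2 + y)) := by
  set k := IsLocalRing.ResidueField V.integers
  have h2' : (2 : k) = 0 := V.residueField_two_eq_zero h2
  let φ : k →+ k := AddMonoidHom.mk' (fun y => y ^ 2 + y) fun a b => by linear_combination a * b * h2'
  have hφ (y : k) : φ y = y ^ 2 + y := rfl
  have key (z : V.integers) (hz : IsLocalRing.residue V.integers z ∈ φ.range) :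
      ∃ y, 0 ≤ V.v y ∧ 0 < V.v ((z : F) - (y ^ 2 + y)) := by
    obtain ⟨y, hy⟩ := hz
    obtain ⟨y, rfl⟩ := IsLocalRing.residue_surjective y
    refine ⟨y, y.2, ?_⟩
    rw [hφ, ← map_pow, ← map_add, eq_comm, ← sub_eq_zero, ← map_sub,
      IsLocalRing.residue_eq_zero_iff, mem_maximalIdeal_integers] at hy
    exact hy
  have hker : Nat.card φ.ker = 2 := by
    have : (φ.ker : Set k) = {0, 1} := by
      ext y
      simp only [SetLike.mem_coe, AddMonoidHom.mem_ker, hφ, Set.mem_insert_iff,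
        Set.mem_singleton_iff]
      rw [show y ^ 2 + y = y * (y - 1) by linear_combination y * h2', mul_eq_zero, sub_eq_zero]
    rw [← SetLike.coe_sort_coe, this, Nat.card_coe_set_eq, Set.ncard_pair zero_ne_one]
  have hindex : φ.range.index = 2 := by
    have h1 := φ.range.card_mul_index
    have h3 := φ.ker.card_mul_index
    rw [AddSubgroup.index_ker, hker] at h3
    have : 0 < Nat.card φ.range := Nat.card_pos
    have : Nat.card φ.range * φ.range.index = Nat.card φ.range * 2 := by
      rw [h1, ← h3, mul_comm]
    exact Nat.eq_of_mul_eq_mul_left ‹_› this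
  by_cases h1 : IsLocalRing.residue V.integers ⟨σ, hσ⟩ ∈ φ.range
  · exact .inl (key _ h1)
  by_cases h3 : IsLocalRing.residue V.integers ⟨ρ, hρ⟩ ∈ φ.range
  · exact .inr (.inl (key _ h3))
  refine .inr (.inr (key (⟨σ, hσ⟩ + ⟨ρ, hρ⟩) ?_))
  rw [map_add, AddSubgroup.add_mem_iff_of_index_two hindex]
  tauto

end NormDiscValuation

namespace NormDiscValuation

/-- Every `2`-adic unit is the cube of a `2`-adic unit. -/
theorem _root_.PadicInt.exists_pow_three_eq (u : ℤ_[2]ˣ) : ∃ w : ℤ_[2]ˣ, w ^ 3 = u := by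
  have h3 : ‖(3 : ℤ_[2])‖ = 1 := by
    rw [show (3 : ℤ_[2]) = ((3 : ℕ) : ℤ_[2]) by norm_num, PadicInt.norm_natCast_eq_one_iff]
    norm_num
  have h1 : ‖(1 : ℤ_[2]) - u‖ < 1 := by
    have key (z : ℤ_[2]) : ‖z‖ < 1 ↔ PadicInt.toZMod z = 0 := by
      rw [← RingHom.mem_ker, PadicInt.ker_toZMod, IsLocalRing.mem_maximalIdeal,
        PadicInt.mem_nonunits]
    rw [key, map_sub, map_one]
    have hu : IsUnit (PadicInt.toZMod (u : ℤ_[2])) := u.isUnit.map _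
    revert hu
    generalize PadicInt.toZMod (u : ℤ_[2]) = z
    revert z
    decide
  obtain ⟨w, hw, -⟩ := hensels_lemma (p := 2) (R := ℤ_[2])
    (F := Polynomial.X ^ 3 - Polynomial.C (u : ℤ_[2])) (a := 1) (by simpa [show (2 + 1 : ℤ_[2]) = 3 by norm_num, h3] using h1)
  have hw : w ^ 3 = u := by simpa [sub_eq_zero] using hw
  have hwu : IsUnit w := by
    rw [← isUnit_pow_iff three_ne_zero, hw]
    exact u.isUnit
  exact ⟨hwu.unit, Units.ext hw⟩

variable [Field F] (V : NormDiscValuation F)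

theorem v_algebraMap_padicUnit [Algebra ℚ_[2] F] (u : ℤ_[2]ˣ) :
    V.v (algebraMap ℚ_[2] F ((u : ℤ_[2]) : ℚ_[2])) = 0 := by
  have hne (u : ℤ_[2]ˣ) : algebraMap ℚ_[2] F ((u : ℤ_[2]) : ℚ_[2]) ≠ 0 := by simp
  choose f hf using fun u : ℤ_[2]ˣ => WithTop.ne_top_iff_exists.1 (V.v_ne_top _ (hne u))
  have key (n : ℕ) : ∀ u, (3 : ℤ) ^ n ∣ f u := by
    induction n with
    | zero => simp
    | succ n ih =>
      intro u
      obtain ⟨w, rfl⟩ := PadicInt.exists_pow_three_eq u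
      have h : f (w ^ 3) = 3 * f w := by
        have := hf (w ^ 3)
        rw [Units.val_pow_eq_pow_val, PadicInt.coe_pow, map_pow, v_pow, ← hf w] at this
        rw [← WithTop.coe_nsmul] at this
        simpa [← WithTop.coe_natCast, ← WithTop.coe_ofNat, ← WithTop.coe_mul] using this
      rw [h, pow_succ']
      exact mul_dvd_mul_left 3 (ih w)
  rw [← hf u]
  have h0 : f u = 0 := by
    by_contra h
    have h1 := Int.natAbs_dvd_natAbs.2 (key (f u).natAbs u)
    have h2 := Nat.le_of_dvd (Int.natAbs_pos.2 h) h1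
    rw [Int.natAbs_pow] at h2
    exact absurd h2 (not_le.2 (Nat.lt_pow_self (by norm_num)))
  rw [h0]
  rfl

theorem v_algebraMap_padic [Algebra ℚ_[2] F] {e : ℤ} (he : V.v 2 = e) {q : ℚ_[2]} (hq : q ≠ 0) :
    V.v (algebraMap ℚ_[2] F q) = ((q.valuation * e : ℤ) : WithTop ℤ) := by
  have hz (n : ℤ) : V.v ((2 : F) ^ n) = ((n * e : ℤ) : WithTop ℤ) := by
    have hn (n : ℕ) : V.v ((2 : F) ^ n) = ((n * e : ℤ) : WithTop ℤ) := by
      rw [v_pow, he, ← WithTop.coe_nsmul, nsmul_eq_mul]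
    cases n with
    | ofNat n => simpa using hn n
    | negSucc n =>
      rw [zpow_negSucc, v_inv, hn, ← WithTop.LinearOrderedAddCommGroup.coe_neg, Int.negSucc_eq]
      exact congrArg ((↑) : ℤ → WithTop ℤ) (by push_cast; ring)
  have hu : ‖q * (2 : ℚ_[2]) ^ (-q.valuation)‖ = 1 := by
    rw [norm_mul, Padic.norm_eq_zpow_neg_valuation hq, norm_zpow]
    rw [show ‖(2 : ℚ_[2])‖ = 2⁻¹ by simpa using Padic.norm_p (p := 2), Nat.cast_ofNat,
      ← mul_zpow, mul_inv_cancel₀ two_ne_zero, one_zpow]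
  have h := V.v_algebraMap_padicUnit (PadicInt.mkUnits hu)
  rw [PadicInt.mkUnits_eq, map_mul, map_zpow₀, map_ofNat, v_mul, hz] at h
  have hne := V.v_ne_top (algebraMap ℚ_[2] F q) (by simpa)
  lift V.v (algebraMap ℚ_[2] F q) to ℤ using hne with n
  norm_cast at h ⊢
  linarith

theorem v_two_pos [Algebra ℚ_[2] F] [FiniteDimensional ℚ_[2] F] {e : ℤ} (he : V.v 2 = e) :
    0 < e := by
  refine lt_of_le_of_ne (by exact_mod_cast he ▸ V.v_natCast_nonneg 2) fun h0 => ?_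
  obtain ⟨x, hx⟩ := V.v_surj (-1)
  let f : ℚ_[2] →+* V.integers := (algebraMap ℚ_[2] F).codRestrict V.integers.toSubring fun q => by
    change 0 ≤ V.v _
    by_cases hq : q = 0
    · simp [hq, V.v_zero]
    · rw [V.v_algebraMap_padic he hq, ← h0]
      simp
  have hint : IsIntegral V.integers x := by
    obtain ⟨p, hp, hpx⟩ := Algebra.IsIntegral.isIntegral (R := ℚ_[2]) x
    refine ⟨p.map f, hp.map f, ?_⟩
    rw [Polynomial.eval₂_map]
    exact hpx
  obtain ⟨y, rfl⟩ := IsIntegrallyClosed.isIntegral_iff.1 hint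
  have := V.mem_integers.1 y.2
  rw [show V.v y = _ from hx] at this
  norm_cast at this

/-- The absolute value on a finite extension of `ℚ_[2]` extending the `2`-adic one. -/
def absoluteValue {e : ℤ} (he : 0 < e) : AbsoluteValue F ℝ where
  toFun x := if x = 0 then 0 else (2⁻¹ : ℝ) ^ (((V.v x).untopD 0 : ℤ) / e : ℝ)
  map_mul' x y := by
    by_cases hx : x = 0
    · simp [hx]
    by_cases hy : y = 0
    · simp [hy]
    have h1 := V.v_ne_top x hx
    have h2 := V.v_ne_top y hy
    simp only [hx, hy, mul_eq_zero, or_self, if_false, V.v_mul]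
    lift V.v x to ℤ using h1 with m
    lift V.v y to ℤ using h2 with n
    rw [← WithTop.coe_add, ← Real.rpow_add (by norm_num)]
    simp [add_div]
  nonneg' x := by
    split_ifs
    · rfl
    · positivity
  eq_zero' x := by
    split_ifs with h
    · simp [h]
    · simp only [h, iff_false]
      positivity
  add_le' x y := by
    by_cases hx : x = 0
    · simp [hx]
    by_cases hy : y = 0
    · simp [hy]
    by_cases hxy : x + y = 0
    · simp only [hxy, if_true]
      positivity
    have h1 := V.v_ne_top x hx
    have h2 := V.v_ne_top y hy
    have h3 := V.v_ne_top (x + y) hxy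
    have h := V.v_add x y
    simp only [hx, hy, hxy, if_false]
    lift V.v x to ℤ using h1 with m
    lift V.v y to ℤ using h2 with n
    lift V.v (x + y) to ℤ using h3 with k
    simp only [WithTop.untopD_coe]
    have he' : (0 : ℝ) < e := by exact_mod_cast he
    have key {m : ℤ} (hm : m ≤ k) : (2⁻¹ : ℝ) ^ ((k : ℝ) / e) ≤ (2⁻¹ : ℝ) ^ ((m : ℝ) / e) :=
      Real.rpow_le_rpow_of_exponent_ge (by norm_num) (by norm_num) (by gcongr)
    rcases min_le_iff.1 h with h | h
    · exact (key (by exact_mod_cast h)).trans (le_add_of_nonneg_right (by positivity))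
    · exact (key (by exact_mod_cast h)).trans (le_add_of_nonneg_left (by positivity))

theorem absoluteValue_le_iff {e : ℤ} (he : 0 < e) (x y : F) :
    V.absoluteValue he x ≤ V.absoluteValue he y ↔ V.v y ≤ V.v x := by
  by_cases hx : x = 0
  · simp [hx, V.v_zero]
  by_cases hy : y = 0
  · simp [hy, hx, V.v_zero, v_eq_top_iff]
  change (if x = 0 then 0 else (2⁻¹ : ℝ) ^ (((V.v x).untopD 0 : ℤ) / e : ℝ)) ≤
    (if y = 0 then 0 else (2⁻¹ : ℝ) ^ (((V.v y).untopD 0 : ℤ) / e : ℝ)) ↔ _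
  have h1 := V.v_ne_top x hx
  have h2 := V.v_ne_top y hy
  rw [if_neg hx, if_neg hy]
  lift V.v x to ℤ using h1 with m
  lift V.v y to ℤ using h2 with n
  have he' : (0 : ℝ) < e := by exact_mod_cast he
  rw [Real.rpow_le_rpow_left_iff_of_base_lt_one (by norm_num) (by norm_num),
    div_le_div_iff_of_pos_right he']
  simp

theorem absoluteValue_le_one_iff {e : ℤ} (he : 0 < e) (x : F) :
    V.absoluteValue he x ≤ 1 ↔ 0 ≤ V.v x := by
  rw [← map_one (V.absoluteValue he), absoluteValue_le_iff, v_one]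

theorem absoluteValue_lt_one_iff {e : ℤ} (he : 0 < e) (x : F) :
    V.absoluteValue he x < 1 ↔ 0 < V.v x := by
  rw [← not_le, ← map_one (V.absoluteValue he), absoluteValue_le_iff, v_one, not_le]

theorem absoluteValue_algebraMap [Algebra ℚ_[2] F] {e : ℤ} (h2 : V.v 2 = e) (he : 0 < e)
    (q : ℚ_[2]) : V.absoluteValue he (algebraMap ℚ_[2] F q) = ‖q‖ := by
  by_cases hq : q = 0
  · simp [hq]
  change (if _ then 0 else (2⁻¹ : ℝ) ^ (((V.v _).untopD 0 : ℤ) / e : ℝ)) = _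
  rw [if_neg (by simpa), V.v_algebraMap_padic h2 hq, Padic.norm_eq_zpow_neg_valuation hq,
    WithTop.untopD_coe]
  have he' : (e : ℝ) ≠ 0 := by exact_mod_cast he.ne'
  rw [Int.cast_mul, mul_div_cancel_right₀ _ he', Real.rpow_intCast]
  simp

/-- The normed field structure on `F` given by `absoluteValue`. -/
abbrev normedField {e : ℤ} (he : 0 < e) : NormedField F := (V.absoluteValue he).toNormedField

theorem isUltrametricDist {e : ℤ} (he : 0 < e) :
    letI := V.normedField he
    IsUltrametricDist F := by
  let := V.normedField he
  refine IsUltrametricDist.isUltrametricDist_of_forall_norm_add_le_max_norm fun x y => ?_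
  rw [le_max_iff]
  exact (min_le_iff.1 (V.v_add x y)).imp (V.absoluteValue_le_iff he _ _).2
    (V.absoluteValue_le_iff he _ _).2

/-- The normed space structure over `ℚ_[2]` compatible with `normedField`. -/
abbrev normedSpace [Algebra ℚ_[2] F] {e : ℤ} (h2 : V.v 2 = e) (he : 0 < e) :
    letI := V.normedField he
    NormedSpace ℚ_[2] F :=
  letI := V.normedField he
  { (inferInstance : Algebra ℚ_[2] F).toModule with
    norm_smul_le := fun q x => by
      rw [Algebra.smul_def, norm_mul]
      exact le_of_eq (congrArg (· * ‖x‖) (V.absoluteValue_algebraMap h2 he q)) }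

theorem finite_residueField [Algebra ℚ_[2] F] [FiniteDimensional ℚ_[2] F] {e : ℤ}
    (h2 : V.v 2 = e) :
    Finite (IsLocalRing.ResidueField V.integers) := by
  have he := V.v_two_pos h2
  let := V.normedField he
  let := V.normedSpace h2 he
  have : ProperSpace F := FiniteDimensional.proper ℚ_[2] F
  obtain ⟨t, ht, htf, htc⟩ := totallyBounded_iff_subset.1
    (isCompact_closedBall (0 : F) 1).totallyBounded _ (Metric.dist_mem_uniformity one_pos)
  have hto (x) (hx : x ∈ t) : x ∈ V.integers := by
    have := ht hx
    rw [mem_closedBall_zero_iff] at this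
    exact (V.absoluteValue_le_one_iff he x).1 this
  have := htf.to_subtype
  refine Finite.of_surjective
    (fun x : t => IsLocalRing.residue V.integers ⟨x, hto x x.2⟩) fun y => ?_
  obtain ⟨y, rfl⟩ := IsLocalRing.residue_surjective y
  have hy : (y : F) ∈ Metric.closedBall (0 : F) 1 := by
    rw [mem_closedBall_zero_iff]
    exact (V.absoluteValue_le_one_iff he _).2 y.2
  obtain ⟨x, hx, hxy⟩ := Set.mem_iUnion₂.1 (htc hy)
  refine ⟨⟨x, hx⟩, ?_⟩
  rw [eq_comm, ← sub_eq_zero, ← map_sub, IsLocalRing.residue_eq_zero_iff, mem_maximalIdeal_integers,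
    ← V.absoluteValue_lt_one_iff he]
  have : dist (y : F) x < 1 := hxy
  rwa [dist_eq_norm] at this

/-- Hensel's lemma for the Artin--Schreier polynomial. -/
theorem exists_sq_add_self_eq [Algebra ℚ_[2] F] [FiniteDimensional ℚ_[2] F] {e : ℤ}
    (h2 : V.v 2 = e) {σ : F} (hσ : 0 < V.v σ) : ∃ y, y ^ 2 + y = σ := by
  have he := V.v_two_pos h2
  let := V.normedField he
  let := V.normedSpace h2 he
  have : CompleteSpace F := FiniteDimensional.complete ℚ_[2] F
  have := V.isUltrametricDist he
  have hσ1 : ‖σ‖ < 1 := (V.absoluteValue_lt_one_iff he σ).2 hσ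
  let y (n : ℕ) : F := (fun z => σ - z ^ 2)^[n] 0
  have hy (n : ℕ) : y (n + 1) = σ - y n ^ 2 := Function.iterate_succ_apply' _ _ _
  have hnorm (n : ℕ) : ‖y n‖ ≤ ‖σ‖ := by
    induction n with
    | zero => simp [y]
    | succ n ih =>
      rw [hy, sub_eq_add_neg]
      refine (IsUltrametricDist.norm_add_le_max _ _).trans (max_le le_rfl ?_)
      rw [norm_neg, norm_pow]
      exact (pow_le_of_le_one (norm_nonneg _) (ih.trans hσ1.le) two_ne_zero).trans ih
  have hdist (n : ℕ) : dist (y n) (y (n + 1)) ≤ ‖σ‖ * ‖σ‖ ^ n := by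
    induction n with
    | zero => simp [y, dist_eq_norm]
    | succ n ih =>
      rw [dist_eq_norm, hy (n + 1), hy n] at *
      rw [← hy n] at *
      rw [show y (n + 1) - (σ - y (n + 1) ^ 2) = -((y n + y (n + 1)) * (y n - y (n + 1))) by
        linear_combination hy n, norm_neg, norm_mul, pow_succ']
      exact mul_le_mul ((IsUltrametricDist.norm_add_le_max _ _).trans
        (max_le (hnorm n) (hnorm (n + 1)))) ih (norm_nonneg _) (norm_nonneg _)
  obtain ⟨z, hz⟩ := cauchySeq_tendsto_of_complete (cauchySeq_of_le_geometric _ _ hσ1 hdist)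
  refine ⟨z, ?_⟩
  have h1 : Filter.Tendsto (fun n => y (n + 1)) Filter.atTop (nhds (σ - z ^ 2)) := by
    simp only [hy]
    exact tendsto_const_nhds.sub (hz.pow 2)
  have := tendsto_nhds_unique h1 ((Filter.tendsto_add_atTop_iff_nat 1).2 hz)
  linear_combination -this

end NormDiscValuation

namespace NormDiscValuation

variable [Field F] (V : NormDiscValuation F)

theorem exists_sq_eq_of_artinSchreier [Algebra ℚ_[2] F] [FiniteDimensional ℚ_[2] F] {e : ℤ}
    (h2 : V.v 2 = e) {σ y : F} (hy : 0 ≤ V.v y) (hσ : 0 < V.v (σ - (y ^ 2 + y))) :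
    ∃ r, r ^ 2 = 1 + 4 * σ := by
  have he : 0 < V.v 2 := by
    rw [h2]
    exact_mod_cast V.v_two_pos h2
  have hu : V.v (1 + 2 * y) = 0 := by
    rw [← V.v_one]
    refine V.v_add_eq_left ?_
    rw [V.v_one]
    exact V.v_mul_pos he hy
  have hne : 1 + 2 * y ≠ 0 := fun h => by simp [h, V.v_zero] at hu
  obtain ⟨z, hz⟩ := V.exists_sq_add_self_eq h2
    (σ := (σ - (y ^ 2 + y)) * (((1 + 2 * y) ^ 2)⁻¹)) (V.v_mul_pos hσ (by simp [v_inv, v_pow, hu]))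
  refine ⟨(1 + 2 * y) * (1 + 2 * z), ?_⟩
  rw [eq_mul_inv_iff_mul_eq₀ (pow_ne_zero 2 hne)] at hz
  linear_combination 4 * hz

/-- The norm form of the unramified quadratic extension represents every unit. -/
theorem exists_sq_sub_mul_sq_eq [Algebra ℚ_[2] F] [FiniteDimensional ℚ_[2] F] {e : ℤ}
    (h2 : V.v 2 = e) {Δ s ρ u : F} (hΔ : Δ * s ^ 2 = 1 + 4 * ρ) (hρ0 : ρ ≠ 0) (hρ : 0 ≤ V.v ρ)
    (hu : V.v u = 0) : ∃ x y, x ^ 2 - Δ * y ^ 2 = u := by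
  have he : 0 < V.v 2 := by
    rw [h2]
    exact_mod_cast V.v_two_pos h2
  have h20 : (2 : F) ≠ 0 := fun h => by simp [h, V.v_zero] at h2
  have := V.finite_residueField h2
  obtain ⟨t, -, ht⟩ := V.exists_sub_sq_pos he hu.ge
  have htu : V.v (t ^ 2) = 0 := by
    rw [← hu, show t ^ 2 = u + -(u - t ^ 2) by ring]
    refine V.v_add_eq_left ?_
    rwa [v_neg, hu]
  have ht0 : t ≠ 0 := fun h => by simp [h, V.v_zero] at htu
  obtain ⟨y, hy⟩ := V.exists_sq_add_self_eq h2 (σ := (u - t ^ 2) * (-ρ * (t ^ 2)⁻¹))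
    (V.v_mul_pos ht (V.v_mul_nonneg (by rwa [v_neg]) (by rw [v_inv, htu, neg_zero])))
  refine ⟨t - t * y / ρ / 2, t * y / ρ / 2 * s, ?_⟩
  rw [mul_pow, mul_left_comm, hΔ]
  field_simp at hy ⊢
  linear_combination (-4 * ρ) * hy

theorem exists_mul_sq_eq_of_le_relDefect {e : ℤ} (h2 : V.v 2 = e) (he : 0 < e) {c : F}
    (hc : c ≠ 0) (h : ((2 * e : ℤ) : WithTop ℤ) ≤ relDefect V c) :
    ∃ s σ, s ≠ 0 ∧ 0 ≤ V.v σ ∧ c * s ^ 2 = 1 + 4 * σ := by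
  have h20 : (2 : F) ≠ 0 := fun h => by simp [h, V.v_zero] at h2
  obtain ⟨x, hx⟩ : ∃ x, ((2 * e : ℤ) : WithTop ℤ) ≤ V.v ((c - x ^ 2) / c) := by
    by_contra! hlt
    have : relDefect V c ≤ ((2 * e - 1 : ℤ) : WithTop ℤ) := ciSup_le fun x => by
      have hx := hlt x
      obtain ⟨n, hn⟩ := WithTop.ne_top_iff_exists.1 hx.ne_top
      rw [← hn] at hx ⊢
      norm_cast at hx ⊢
      omega
    have := h.trans this
    norm_cast at this
    omega
  have h4 : V.v (4 : F)⁻¹ = ((-(2 * e) : ℤ) : WithTop ℤ) := by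
    rw [v_inv, show (4 : F) = 2 * 2 by norm_num, v_mul, h2, ← WithTop.coe_add,
      ← WithTop.LinearOrderedAddCommGroup.coe_neg, two_mul]
  have h40 : (4 : F) ≠ 0 := by
    rw [show (4 : F) = 2 * 2 by norm_num]
    exact mul_ne_zero h20 h20
  have hx0 : x ≠ 0 := by
    rintro rfl
    rw [zero_pow two_ne_zero, sub_zero, div_self hc, v_one] at hx
    norm_cast at hx
    omega
  have hτ : 0 ≤ V.v ((c - x ^ 2) / c * 4⁻¹) := by
    rw [v_mul, h4]
    refine le_trans ?_ (add_le_add_left hx _)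
    norm_cast
    omega
  refine ⟨x / c, -((c - x ^ 2) / c * 4⁻¹), div_ne_zero hx0 hc, by rwa [v_neg], ?_⟩
  field_simp
  ring

theorem not_isSquare_of_relDefect_ne_top {c : F} (h : relDefect V c ≠ ⊤) (r : F) : r ^ 2 ≠ c := by
  rintro rfl
  refine h (top_le_iff.1 ?_)
  refine le_trans ?_ (le_ciSup (OrderTop.bddAbove _) r)
  simp [V.v_zero]

/-- An element of relative quadratic defect at least `2 e` is a square or in the square class
of `Δ`. -/
theorem eq_sq_or_mul_sq_eq [Algebra ℚ_[2] F] [FiniteDimensional ℚ_[2] F] {e : ℤ}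
    (h2 : V.v 2 = e) {Δ c : F} (hΔ0 : Δ ≠ 0) (hΔ : relDefect V Δ = ((2 * e : ℤ) : WithTop ℤ))
    (hc : c ≠ 0) (h : ((2 * e : ℤ) : WithTop ℤ) ≤ relDefect V c) :
    (∃ r, r ≠ 0 ∧ c = r ^ 2) ∨ ∃ r, r ≠ 0 ∧ c * r ^ 2 = Δ := by
  have he := V.v_two_pos h2
  have he' : 0 < V.v 2 := by
    rw [h2]
    exact_mod_cast he
  obtain ⟨s, σ, hs, hσ, hcs⟩ := V.exists_mul_sq_eq_of_le_relDefect h2 he hc h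
  obtain ⟨s', ρ, hs', hρ, hΔs⟩ := V.exists_mul_sq_eq_of_le_relDefect h2 he hΔ0 hΔ.ge
  have := V.finite_residueField h2
  rcases V.exists_sub_artinSchreier_pos he' hσ hρ with ⟨y, hy, hy'⟩ | ⟨y, hy, hy'⟩ | ⟨y, hy, hy'⟩
  · obtain ⟨r, hr⟩ := V.exists_sq_eq_of_artinSchreier h2 hy hy'
    rw [← hcs] at hr
    refine .inl ⟨r / s, div_ne_zero (fun h0 => ?_) hs, ?_⟩
    · rw [h0, zero_pow two_ne_zero, zero_eq_mul] at hr
      exact hr.elim hc (pow_ne_zero 2 hs)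
    · rw [div_pow, hr, mul_div_cancel_right₀ _ (pow_ne_zero 2 hs)]
  · obtain ⟨r, hr⟩ := V.exists_sq_eq_of_artinSchreier h2 hy hy'
    rw [← hΔs] at hr
    refine absurd ?_ (V.not_isSquare_of_relDefect_ne_top (hΔ ▸ WithTop.coe_ne_top) (r / s'))
    rw [div_pow, hr, mul_div_cancel_right₀ _ (pow_ne_zero 2 hs')]
  · have h4 : 0 < V.v (2 * (2 * (σ * ρ))) :=
      V.v_mul_pos he' (V.v_mul_nonneg he'.le (V.v_mul_nonneg hσ hρ))
    obtain ⟨r, hr⟩ := V.exists_sq_eq_of_artinSchreier h2 (σ := σ + ρ + 2 * (2 * (σ * ρ))) hy (by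
      rw [add_sub_right_comm]
      exact V.lt_v_add hy' h4)
    have hr : r ^ 2 = c * s ^ 2 * (Δ * s' ^ 2) := by
      rw [hr, hcs, hΔs]
      ring
    have hr0 : r ≠ 0 := by
      rw [← pow_ne_zero_iff two_ne_zero, hr]
      positivity
    refine .inr ⟨s * Δ * s' / r, by positivity, ?_⟩
    field_simp
    linear_combination -hr

end NormDiscValuation

section PairMoves

variable [Field F]

/-- Replacing two weights `w p, w q` of a diagonal form by `u, w p * w q * u * z ^ 2`, where `u ≠ 0`
is represented by the binary form `[w p, w q]`, gives an equivalent form. -/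
theorem diagQF_equivalent_of_pair {n : ℕ} {w w' : ℕ → F} {p q : ℕ} (hp : p < n) (hq : q < n)
    (hpq : p ≠ q) (hww' : ∀ i, i ≠ p → i ≠ q → w' i = w i) {s t z : F} (hz : z ≠ 0)
    (hu0 : w' p ≠ 0) (hu : w p * s ^ 2 + w q * t ^ 2 = w' p)
    (hq' : w' q = w p * w q * w' p * z ^ 2) :
    QuadraticMap.Equivalent (diagQF n fun i : Fin n => w i) (diagQF n fun i : Fin n => w' i) := by
  let P : Fin n := ⟨p, hp⟩
  let Q : Fin n := ⟨q, hq⟩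
  have hPQ : P ≠ Q := fun h => hpq (congrArg Fin.val h)
  let f : (Fin n → F) →ₗ[F] (Fin n → F) :=
    { toFun := fun v i => if i = P then s * v P - w q * t * z * v Q
        else if i = Q then t * v P + w p * s * z * v Q else v i
      map_add' := fun v v' => by
        ext i
        simp only [Pi.add_apply]
        split_ifs <;> ring
      map_smul' := fun c v => by
        ext i
        simp only [Pi.smul_apply, smul_eq_mul, RingHom.id_apply]
        split_ifs <;> ring }
  have hf (v : Fin n → F) (i : Fin n) : f v i = if i = P then s * v P - w q * t * z * v Q
      else if i = Q then t * v P + w p * s * z * v Q else v i := rfl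
  have hinj : Function.Injective f := by
    refine (injective_iff_map_eq_zero f).2 fun v hv => ?_
    have h1 := congrFun hv P
    have h2 := congrFun hv Q
    simp only [hf, if_true, if_neg hPQ.symm, Pi.zero_apply] at h1 h2
    have hP : v P = 0 := by
      have : w' p * v P = 0 := by
        rw [← hu]
        linear_combination w p * s * h1 + w q * t * h2
      exact (mul_eq_zero.1 this).resolve_left hu0
    have hQ : v Q = 0 := by
      have : w' p * z * v Q = 0 := by
        rw [← hu]
        linear_combination s * h2 - t * h1
      exact (mul_eq_zero.1 this).resolve_left (mul_ne_zero hu0 hz)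
    ext i
    by_cases hi : i = P
    · rw [hi, hP, Pi.zero_apply]
    by_cases hi' : i = Q
    · rw [hi', hQ, Pi.zero_apply]
    have := congrFun hv i
    rwa [hf, if_neg hi, if_neg hi'] at this
  refine QuadraticMap.Equivalent.symm ⟨⟨LinearEquiv.ofInjectiveEndo f hinj, fun v => ?_⟩⟩
  change diagQF n _ (f v) = diagQF n _ v
  rw [diagQF, diagQF, QuadraticMap.weightedSumSquares_apply, QuadraticMap.weightedSumSquares_apply,
    ← sub_eq_zero, ← Finset.sum_sub_distrib, Fintype.sum_eq_add P Q hPQ]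
  · simp only [hf, if_true, if_neg hPQ.symm, smul_eq_mul, P, Q]
    rw [hq', ← hu]
    ring
  · rintro i ⟨hi, hi'⟩
    rw [hf, if_neg hi, if_neg hi', hww' i (fun h => hi (Fin.ext h)) (fun h => hi' (Fin.ext h)),
      sub_self]

/-- The first `2 * k` weights are `1, -1, …, 1, -1, 1, c` and the others those of `w`. -/
def partialPad (w : ℕ → F) (k : ℕ) (c : F) (i : ℕ) : F :=
  if i + 1 < 2 * k then (if i % 2 = 0 then 1 else -1) else if i + 1 = 2 * k then c else w i

theorem partialPad_zero (w : ℕ → F) (c : F) : partialPad w 0 c = w := by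
  ext i
  simp [partialPad]

/-- If every pair `w (2 * k), w (2 * k + 1)` spans a hyperbolic plane or a plane which can be
written as both `[1, -Δ]` and `[Δ, -1]`, then the form with weights `w` is an orthogonal sum of
hyperbolic planes, up to one plane `[1, -Δ]`. -/
theorem diagQF_equivalent_partialPad {n : ℕ} (w : ℕ → F) {Δ : F} (hΔ : Δ ≠ 0)
    (hw : ∀ k, 2 * k + 2 ≤ n → w (2 * k) ≠ 0 ∧
      ((∃ r, r ≠ 0 ∧ -(w (2 * k) * w (2 * k + 1)) = r ^ 2) ∨
        (∃ r, r ≠ 0 ∧ -(w (2 * k) * w (2 * k + 1)) * r ^ 2 = Δ) ∧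
        (∃ s t, w (2 * k) * s ^ 2 + w (2 * k + 1) * t ^ 2 = 1) ∧
        ∃ s t, w (2 * k) * s ^ 2 + w (2 * k + 1) * t ^ 2 = Δ)) (h2 : (2 : F) ≠ 0)
    (k : ℕ) (hk : 2 * k ≤ n) : ∃ c, (c = -1 ∨ c = -Δ ∧ 1 ≤ k) ∧
      QuadraticMap.Equivalent (diagQF n fun i : Fin n => w i)
        (diagQF n fun i : Fin n => partialPad w k c i) := by
  induction k with
  | zero => exact ⟨-1, .inl rfl, by rw [partialPad_zero]⟩
  | succ k ih =>
    obtain ⟨c, hc, hE⟩ := ih (by omega)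
    obtain ⟨h0, hpair⟩ := hw k (by omega)
    have v1 (c) : partialPad w k c (2 * k) = w (2 * k) := by
      rw [partialPad, if_neg (by omega), if_neg (by omega)]
    have v2 (c) : partialPad w k c (2 * k + 1) = w (2 * k + 1) := by
      rw [partialPad, if_neg (by omega), if_neg (by omega)]
    have v3 (c) : partialPad w (k + 1) c (2 * k) = 1 := by
      rw [partialPad, if_pos (by omega), if_pos (by omega)]
    have v4 (c) : partialPad w (k + 1) c (2 * k + 1) = c := by
      rw [partialPad, if_neg (by omega), if_pos (by omega)]
    have v5 (c) (hk : 1 ≤ k) : partialPad w k c (2 * k - 1) = c := by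
      rw [partialPad, if_neg (by omega), if_pos (by omega)]
    have v6 (c) (hk : 1 ≤ k) : partialPad w (k + 1) c (2 * k - 1) = -1 := by
      rw [partialPad, if_pos (by omega), if_neg (by omega)]
    have v7 (c c') (i) (h1 : i + 1 ≠ 2 * k) (h2 : i ≠ 2 * k) (h3 : i ≠ 2 * k + 1) :
        partialPad w (k + 1) c i = partialPad w k c' i := by
      rw [partialPad, partialPad, if_neg h1, if_neg (by omega : i + 1 ≠ 2 * (k + 1))]
      exact if_congr (by omega) rfl rfl
    have v8 (i) (h2 : i ≠ 2 * k) (h3 : i ≠ 2 * k + 1) (c) :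
        partialPad w (k + 1) c i = partialPad w k (-1) i := by
      by_cases h1 : i + 1 = 2 * k
      · obtain rfl : i = 2 * k - 1 := by omega
        rw [v6 _ (by omega), v5 _ (by omega)]
      · exact v7 _ _ i h1 h2 h3
    have hyp {a b r : F} (ha : a ≠ 0) (hr : r ≠ 0) (hab : -(a * b) = r ^ 2) :
        a * ((1 + a⁻¹) / 2) ^ 2 + b * (a * ((1 - a⁻¹) / 2) / r) ^ 2 = 1 := by
      field_simp
      linear_combination -(a - 1) ^ 2 * hab
    rcases hc with rfl | ⟨rfl, hk1⟩
    · rcases hpair with ⟨r, hr, hab⟩ | ⟨⟨r, hr, hab⟩, ⟨s, t, hst⟩, -⟩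
      · refine ⟨-1, .inl rfl, hE.trans (diagQF_equivalent_of_pair (p := 2 * k) (q := 2 * k + 1)
          (by omega) (by omega) (by omega) (fun i h h' => v8 i h h' _) (inv_ne_zero hr)
          (by rw [v3]; exact one_ne_zero) (by rw [v1, v2, v3]; exact hyp h0 hr hab) ?_)⟩
        rw [v1, v2, v3, v4]
        field_simp
        linear_combination hab
      · refine ⟨-Δ, .inr ⟨rfl, by omega⟩,
          hE.trans (diagQF_equivalent_of_pair (p := 2 * k) (q := 2 * k + 1)
          (by omega) (by omega) (by omega) (fun i h h' => v8 i h h' _) hr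
          (by rw [v3]; exact one_ne_zero) (by rw [v1, v2, v3]; exact hst) ?_)⟩
        rw [v1, v2, v3, v4]
        linear_combination hab
    · rcases hpair with ⟨r, hr, hab⟩ | ⟨⟨r, hr, hab⟩, -, ⟨s, t, hst⟩⟩
      · let w' (i : ℕ) : F :=
          if i = 2 * k then 1 else if i = 2 * k + 1 then -1 else partialPad w k (-Δ) i
        have w1 : w' (2 * k) = 1 := if_pos rfl
        have w2 : w' (2 * k + 1) = -1 := by simp [w']
        have w3 (i) (h : i ≠ 2 * k) (h' : i ≠ 2 * k + 1) : w' i = partialPad w k (-Δ) i := by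
          simp [w', h, h']
        have w4 : w' (2 * k - 1) = -Δ := by rw [w3 _ (by omega) (by omega), v5 _ hk1]
        refine ⟨-Δ, .inr ⟨rfl, by omega⟩,
          (hE.trans (diagQF_equivalent_of_pair (w' := w') (p := 2 * k) (q := 2 * k + 1)
          (by omega) (by omega) (by omega) w3 (inv_ne_zero hr)
          (by rw [w1]; exact one_ne_zero) (by rw [v1, v2, w1]; exact hyp h0 hr hab) ?_)).trans
          (diagQF_equivalent_of_pair (p := 2 * k - 1) (q := 2 * k + 1) (s := 0) (t := 1) (z := 1)
          (by omega) (by omega) (by omega) (fun i h h' => ?_) one_ne_zero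
          (by rw [v6 _ hk1]; exact neg_ne_zero.2 one_ne_zero) ?_ ?_)⟩
        · rw [v1, v2, w1, w2]
          field_simp
          linear_combination hab
        · by_cases h1 : i = 2 * k
          · rw [h1, v3, w1]
          · rw [w3 i h1 h', v7 _ _ _ (by omega) h1 h']
        · rw [v6 _ hk1, w4, w2]
          ring
        · rw [v6 _ hk1, v4, w4, w2]
          ring
      · let w' (i : ℕ) : F :=
          if i = 2 * k then Δ else if i = 2 * k + 1 then -1 else partialPad w k (-Δ) i
        have w1 : w' (2 * k) = Δ := if_pos rfl
        have w2 : w' (2 * k + 1) = -1 := by simp [w']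
        have w3 (i) (h : i ≠ 2 * k) (h' : i ≠ 2 * k + 1) : w' i = partialPad w k (-Δ) i := by
          simp [w', h, h']
        have w4 : w' (2 * k - 1) = -Δ := by rw [w3 _ (by omega) (by omega), v5 _ hk1]
        refine ⟨-1, .inl rfl,
          (hE.trans (diagQF_equivalent_of_pair (w' := w') (p := 2 * k) (q := 2 * k + 1)
          (by omega) (by omega) (by omega) w3 (div_ne_zero hr hΔ)
          (by rw [w1]; exact hΔ) (by rw [v1, v2, w1]; exact hst) ?_)).trans
          (diagQF_equivalent_of_pair (p := 2 * k - 1) (q := 2 * k) (s := (1 + Δ⁻¹) / 2)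
          (t := (1 - Δ⁻¹) / 2) (by omega) (by omega) (by omega) (fun i h h' => ?_)
          (inv_ne_zero hΔ) (by rw [v6 _ hk1]; exact neg_ne_zero.2 one_ne_zero) ?_ ?_)⟩
        · rw [v1, v2, w1, w2]
          field_simp
          linear_combination hab
        · by_cases h1 : i = 2 * k + 1
          · rw [h1, v4, w2]
          · rw [w3 i h' h1, v7 _ _ _ (by omega) h' h1]
        · rw [v6 _ hk1, w4, w1]
          field_simp
          ring
        · rw [v6 _ hk1, v3, w4, w1]
          field_simp

theorem partialPad_eq_padDiag (w : ℕ → F) {k : ℕ} (hk : 1 ≤ k) (c : F) :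
    (fun i : Fin (2 * k) => partialPad w k c i) = padDiag (2 * k) [1, c] := by
  ext ⟨i, hi⟩
  simp only [partialPad, padDiag, List.length_cons, List.length_nil]
  by_cases h1 : i < 2 * k - 2
  · rw [if_pos (by omega : i + 1 < 2 * k), if_pos (by omega : i < 2 * k - (0 + 1 + 1))]
  rw [if_neg (by omega : ¬ i < 2 * k - (0 + 1 + 1))]
  obtain rfl | rfl : i = 2 * k - 2 ∨ i = 2 * k - 1 := by omega
  · rw [if_pos (by omega), if_pos (by omega)]
    simp
  · rw [if_neg (by omega), if_pos (by omega), show 2 * k - 1 - (2 * k - (0 + 1 + 1)) = 1 by omega]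
    simp

end PairMoves

/-- for an integral lattice with good BONG, if `R_j = -2e` for an even
index `j`, then `[a₁,…,a_j] ≅ ℍ^{j/2}` or `ℍ^{(j-2)/2} ⊥ [1,-Δ]`. -/
theorem bong_space_hyperbolic_or_delta [Field F] [Algebra ℚ_[2] F]
    [FiniteDimensional ℚ_[2] F]
    (V : NormDiscValuation F) (e : ℤ) (he : V.v 2 = (e : WithTop ℤ))
    (m : ℕ) (a : ℕ → F) (R : ℕ → ℤ)
    (hne : ∀ i, 1 ≤ i → i ≤ m → a i ≠ 0)
    (hval : ∀ i, 1 ≤ i → i ≤ m → V.v (a i) = (R i : WithTop ℤ))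
    (hgood : ∀ i, 1 ≤ i → i + 2 ≤ m → R i ≤ R (i + 2))
    (hbong₁ : ∀ i, 1 ≤ i → i + 1 ≤ m →
      (0 : WithTop ℤ) ≤ ((R (i + 1) - R i : ℤ) : WithTop ℤ)
        + relDefect V (-(a i * a (i + 1))))
    (hbong₂ : ∀ i, 1 ≤ i → i + 1 ≤ m → -(2 * e) ≤ R (i + 1) - R i)
    (hint : 0 ≤ R 1)
    (Δ : F) (hΔu : V.v Δ = (0 : WithTop ℤ))
    (hΔd : relDefect V Δ = ((2 * e : ℤ) : WithTop ℤ))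
    (j : ℕ) (hjeven : Even j) (hj1 : 1 ≤ j) (hjm : j ≤ m) (hRj : R j = -(2 * e)) :
    QuadraticMap.Equivalent (diagQF j (fun i : Fin j => a ((i : ℕ) + 1)))
        (diagQF j (padDiag j ([1, -1] : List F))) ∨
      QuadraticMap.Equivalent (diagQF j (fun i : Fin j => a ((i : ℕ) + 1)))
        (diagQF j (padDiag j [1, -Δ])) := by
  obtain ⟨n, rfl⟩ := even_iff_two_dvd.1 hjeven
  have he0 := V.v_two_pos he
  have hΔ0 : Δ ≠ 0 := fun h => by simp [h, V.v_zero] at hΔu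
  have h20 : (2 : F) ≠ 0 := fun h => by simp [h, V.v_zero] at he
  have hlast := hbong₂ (2 * n - 1) (by omega) (by omega)
  rw [Nat.sub_add_cancel hj1, hRj] at hlast
  have hodd_nonneg (k : ℕ) (hk : k + 1 ≤ n) : 0 ≤ R (2 * k + 1) := by
    induction k with
    | zero => exact hint
    | succ k ih => exact (ih (by omega)).trans (hgood (2 * k + 1) (by omega) (by omega))
  have hmono (i k : ℕ) (hi : 1 ≤ i) (hk : i + 2 * k ≤ m) : R i ≤ R (i + 2 * k) := by
    induction k with
    | zero => rfl
    | succ k ih => exact (ih (by omega)).trans (hgood (i + 2 * k) (by omega) (by omega))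
  have hodd (k : ℕ) (hk : 2 * k + 2 ≤ 2 * n) : R (2 * k + 1) = 0 := by
    refine le_antisymm ?_ (hodd_nonneg k (by omega))
    have := hmono (2 * k + 1) (n - 1 - k) (by omega) (by omega)
    rw [show 2 * k + 1 + 2 * (n - 1 - k) = 2 * n - 1 by omega] at this
    linarith
  have heven (k : ℕ) (hk : 2 * k + 2 ≤ 2 * n) : R (2 * k + 2) = -(2 * e) := by
    have h1 := hmono (2 * k + 2) (n - 1 - k) (by omega) (by omega)
    rw [show 2 * k + 2 + 2 * (n - 1 - k) = 2 * n by omega] at h1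
    have h2 := hbong₂ (2 * k + 1) (by omega) (by omega)
    rw [hodd k hk, show 2 * k + 1 + 1 = 2 * k + 2 by ring] at h2
    linarith
  obtain ⟨s, ρ, hs, hρ, hΔs⟩ := V.exists_mul_sq_eq_of_le_relDefect he he0 hΔ0 hΔd.ge
  have hρ0 : ρ ≠ 0 := by
    rintro rfl
    refine V.not_isSquare_of_relDefect_ne_top (hΔd ▸ WithTop.coe_ne_top) s⁻¹ ?_
    field_simp
    linear_combination -hΔs
  have hpairs (k : ℕ) (hk : 2 * k + 2 ≤ 2 * n) : a (2 * k + 1) ≠ 0 ∧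
      ((∃ r, r ≠ 0 ∧ -(a (2 * k + 1) * a (2 * k + 1 + 1)) = r ^ 2) ∨
        (∃ r, r ≠ 0 ∧ -(a (2 * k + 1) * a (2 * k + 1 + 1)) * r ^ 2 = Δ) ∧
        (∃ s t, a (2 * k + 1) * s ^ 2 + a (2 * k + 1 + 1) * t ^ 2 = 1) ∧
        ∃ s t, a (2 * k + 1) * s ^ 2 + a (2 * k + 1 + 1) * t ^ 2 = Δ) := by
    have h1 := hne (2 * k + 1) (by omega) (by omega)
    have h2 := hne (2 * k + 1 + 1) (by omega) (by omega)
    have hdefect : ((2 * e : ℤ) : WithTop ℤ) ≤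
        relDefect V (-(a (2 * k + 1) * a (2 * k + 1 + 1))) := by
      have := hbong₁ (2 * k + 1) (by omega) (by omega)
      rw [hodd k hk, heven k hk] at this
      generalize relDefect V (-(a (2 * k + 1) * a (2 * k + 1 + 1))) = d at this ⊢
      cases d with
      | top => exact le_top
      | coe d =>
        norm_cast at this ⊢
        linarith
    refine ⟨h1, (V.eq_sq_or_mul_sq_eq he hΔ0 hΔd (neg_ne_zero.2 (mul_ne_zero h1 h2))
      hdefect).imp_right fun ⟨r, hr, hab⟩ => ?_⟩
    have hrep (u : F) (hu : V.v u = 0) :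
        ∃ s t, a (2 * k + 1) * s ^ 2 + a (2 * k + 1 + 1) * t ^ 2 = u := by
      obtain ⟨x, y, hxy⟩ := V.exists_sq_sub_mul_sq_eq he (u := a (2 * k + 1) * u) hΔs hρ0 hρ
        (by rw [V.v_mul, hu, hval _ (by omega) (by omega), hodd k hk]; rfl)
      refine ⟨x / a (2 * k + 1), y * r, ?_⟩
      field_simp
      linear_combination hxy - y ^ 2 * hab
    exact ⟨⟨r, hr, hab⟩, hrep 1 V.v_one, hrep Δ hΔu⟩
  obtain ⟨c, hc, hE⟩ := diagQF_equivalent_partialPad (n := 2 * n) (fun i => a (i + 1)) hΔ0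
    hpairs h20 n le_rfl
  rw [partialPad_eq_padDiag _ (by omega)] at hE
  rcases hc with rfl | ⟨rfl, -⟩
  · exact .inl hE
  · exact .inr hE
end
end
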